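/- Let A be the Artin group of type D_4 and let (x_0,…,x_5) be a type II 6-cycle. Then there exists a left coset z of A_â or of A_b̂ such that z ∩ x_1 ≠ ∅, z ∩ x_3 ≠ ∅ and z ∩ x_5 ≠ ∅ (every type II 6-cycle satisfies property (*)). -/

import Mathlib

/-!
The Artin group of type `D₄`, with generators `a, b, c, d`, where `d` is the central node of
the Dynkin diagram: relations `ada = dad`, `bdb = dbd`, `cdc = dcd`, `ab = ba`, `ac = ca`,
`bc = cb`.
-/

open Pointwise

namespace D4Artin

/-- The generators of the `D₄` Artin group. -/
inductive Gen : Type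
  | a | b | c | d
deriving DecidableEq

open Gen

/-- The defining relators of the `D₄` Artin group: a braid relation `sts = tst` whenever one of
`s, t` is the central node `d`, and commutation `st = ts` otherwise. -/
def Rels : Set (FreeGroup Gen) :=
  { r | ∃ s t : Gen, s ≠ t ∧
      (((s = d ∨ t = d) ∧
          r = FreeGroup.of s * FreeGroup.of t * FreeGroup.of s *
              (FreeGroup.of t * FreeGroup.of s * FreeGroup.of t)⁻¹) ∨
        ((s ≠ d ∧ t ≠ d) ∧
          r = FreeGroup.of s * FreeGroup.of t * (FreeGroup.of s)⁻¹ * (FreeGroup.of t)⁻¹)) }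

/-- The Artin group of type `D₄`. -/
abbrev Artin : Type := PresentedGroup Rels

/-- The generators, as elements of the Artin group. -/
def gen (s : Gen) : Artin := PresentedGroup.of s

/-- The standard parabolic subgroup `A_ŝ` generated by the three generators other than `s`. -/
def Ahat (s : Gen) : Subgroup Artin :=
  Subgroup.closure { x | ∃ t : Gen, t ≠ s ∧ x = gen t }

/-- `X` is a left coset of the subgroup `H`. -/
def IsCosetOf (X : Set Artin) (H : Subgroup Artin) : Prop :=
  ∃ g : Artin, X = g • (H : Set Artin)

/-- A type II 6-cycle: `x 0, x 4` are distinct left cosets of `A_â`, `x 2` is a left coset of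
`A_b̂`, `x 1, x 3, x 5` are pairwise distinct left cosets of `A_ĉ`, and consecutive cosets
(indices mod 6) have nonempty intersection. -/
def TypeII (x : Fin 6 → Set Artin) : Prop :=
  IsCosetOf (x 0) (Ahat a) ∧ IsCosetOf (x 4) (Ahat a) ∧ IsCosetOf (x 2) (Ahat b) ∧
  IsCosetOf (x 1) (Ahat c) ∧ IsCosetOf (x 3) (Ahat c) ∧ IsCosetOf (x 5) (Ahat c) ∧
  x 0 ≠ x 4 ∧ x 1 ≠ x 3 ∧ x 1 ≠ x 5 ∧ x 3 ≠ x 5 ∧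
  ∀ i : Fin 6, (x i ∩ x (i + 1)).Nonempty

/-- Property `(*)` for a 6-cycle: there is a left coset of `A_â` or of `A_b̂` meeting each of
`x 1`, `x 3`, `x 5`. -/
def Star (x : Fin 6 → Set Artin) : Prop :=
  ∃ z : Set Artin, (IsCosetOf z (Ahat a) ∨ IsCosetOf z (Ahat b)) ∧
    (z ∩ x 1).Nonempty ∧ (z ∩ x 3).Nonempty ∧ (z ∩ x 5).Nonempty

end D4Artin

namespace D4Artin

section Counting

variable {Γ : Type*} [Group Γ]

/-- A subset of a group is almost invariant if each right translate differs from it by a finite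
set. -/
def AlmostInvariant (F : Set Γ) : Prop :=
  ∀ u : Γ, {g : Γ | ¬(g * u ∈ F ↔ g ∈ F)}.Finite

namespace AlmostInvariant

theorem diff {F F' : Set Γ} (hF : AlmostInvariant F) (hF' : AlmostInvariant F') :
    AlmostInvariant (F \ F') := fun u =>
  ((hF u).union (hF' u)).subset fun g hg => by
    simp only [Set.mem_ofPred_eq, Set.mem_sdiff, Set.mem_union] at hg ⊢
    tauto

theorem translate {F : Set Γ} (hF : AlmostInvariant F) (h : Γ) :
    AlmostInvariant {x | h⁻¹ * x ∈ F} := fun u =>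
  ((hF u).preimage (mul_right_injective h⁻¹).injOn).subset fun g hg => by
    simpa [mul_assoc] using hg

theorem of_generators {F : Set Γ} {S : Set Γ} (hS : Subgroup.closure S = ⊤)
    (hF : ∀ s ∈ S, {g : Γ | ¬(g * s ∈ F ↔ g ∈ F)}.Finite) : AlmostInvariant F := by
  intro u
  have hu : u ∈ Subgroup.closure S := hS ▸ Subgroup.mem_top u
  induction hu using Subgroup.closure_induction with
  | mem x hx => exact hF x hx
  | one => simp
  | mul x y _ _ hx hy =>
    refine (hx.union (hy.preimage (mul_left_injective x).injOn)).subset fun g hg => ?_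
    simp only [Set.mem_ofPred_eq, Set.mem_union, Set.mem_preimage, mul_assoc] at hg ⊢
    tauto
  | inv x _ hx =>
    refine (hx.preimage (mul_left_injective x⁻¹).injOn).subset fun g hg => ?_
    simp only [Set.mem_ofPred_eq, Set.mem_preimage, inv_mul_cancel_right] at hg ⊢
    tauto

theorem map_mulEquiv {F : Set Γ} (hF : AlmostInvariant F) (β : Γ ≃* Γ) :
    AlmostInvariant (β.symm ⁻¹' F) := fun u =>
  ((hF (β.symm u)).preimage β.symm.injective.injOn).subset fun g hg => by
    simpa using hg

open Classical in
theorem finite_support {F : Set Γ} (hF : AlmostInvariant F) (u : Γ) :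
    (Function.support fun g =>
      ((if g * u ∈ F then 1 else 0) - if g ∈ F then 1 else 0 : ℤ)).Finite :=
  (hF u).subset fun g hg => by
    simp only [Function.mem_support, Set.mem_ofPred_eq] at hg ⊢
    contrapose! hg
    simp [hg]

open Classical in
/-- In a group generated by involutions, an almost invariant set gains as many points as it loses
under every right translation. -/
theorem finsum_eq_zero {F : Set Γ} (hF : AlmostInvariant F) {S : Set Γ}
    (hS : Subgroup.closure S = ⊤) (hinv : ∀ s ∈ S, s * s = 1) (u : Γ) :
    ∑ᶠ g, ((if g * u ∈ F then 1 else 0) - if g ∈ F then 1 else 0 : ℤ) = 0 := by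
  set φ : Γ → ℤ := fun g => if g ∈ F then 1 else 0 with hφ
  have key : ∀ u : Γ, (Function.support fun g => φ (g * u) - φ g).Finite :=
    fun u => hF.finite_support u
  change ∑ᶠ g, (φ (g * u) - φ g) = 0
  have hu : u ∈ Subgroup.closure S := hS ▸ Subgroup.mem_top u
  have shift : ∀ (f : Γ → ℤ) (x : Γ), ∑ᶠ g, f (g * x) = ∑ᶠ g, f g := fun f x =>
    finsum_comp_equiv (Equiv.mulRight x)
  induction hu using Subgroup.closure_induction with
  | mem x hx =>
    have h1 := shift (fun g => φ (g * x) - φ g) x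
    simp only [mul_assoc, hinv x hx, mul_one] at h1
    have h2 : ∑ᶠ g, (φ g - φ (g * x)) = - ∑ᶠ g, (φ (g * x) - φ g) := by
      rw [← finsum_neg_distrib]
      simp
    omega
  | one => simp
  | mul x y _ _ hx hy =>
    have h1 := shift (fun g => φ (g * y) - φ g) x
    rw [hy] at h1
    have h2 := finsum_add_distrib (f := fun g => φ (g * x * y) - φ (g * x))
      (g := fun g => φ (g * x) - φ g)
      ((key y).preimage (mul_left_injective x).injOn) (key x)
    rw [h1, hx, add_zero] at h2
    rw [← h2]
    simp [mul_assoc]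
  | inv x _ hx =>
    have h1 := shift (fun g => φ (g * x⁻¹) - φ g) x
    simp only [mul_inv_cancel_right] at h1
    rw [← h1]
    have h2 : ∑ᶠ g, (φ g - φ (g * x)) = - ∑ᶠ g, (φ (g * x) - φ g) := by
      rw [← finsum_neg_distrib]
      simp
    omega

end AlmostInvariant

end Counting

section Helly

variable {Γ Ω : Type*} [Group Γ] [LinearOrder Ω]

/-- The complement of the subgroup `H` is the disjoint union of the translates `h N` of a
half-space `N` by the elements `h` of `H`, and `h N` is the interval `(h, h e]` for the order
pulled back along `ord`. -/
structure Cut (ord : Γ → Ω) (H : Subgroup Γ) (e : Γ) (N : Set Γ) : Prop where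
  mem : e ∈ N
  cover : ∀ x ∉ H, ∃ h ∈ H, h⁻¹ * x ∈ N
  disjoint : ∀ x ∈ N, x ∉ H
  unique : ∀ x, ∀ h ∈ H, ∀ k ∈ H, h⁻¹ * x ∈ N → k⁻¹ * x ∈ N → h = k
  right : ∀ x ∈ N, ∀ h ∈ H, x * h ∈ N
  interval : ∀ h ∈ H, ∀ x, h⁻¹ * x ∈ N ↔ ord h < ord x ∧ ord x ≤ ord (h * e)
  almostInvariant : AlmostInvariant N

variable {ι : Type*} (H : ι → Subgroup Γ) (e : ι → Γ) (N : ι → Set Γ)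

/-- The points of the translate `h N i` lying in no translate `k N j` that contains `h`. -/
def leftPart (i : ι) (h : Γ) : Set Γ :=
  {x | h⁻¹ * x ∈ N i ∧ ∀ j, ∀ k ∈ H j, k⁻¹ * h ∈ N j → k⁻¹ * x ∉ N j}

/-- The half-space `h N i` is visible if its right end lies in no half-space containing `h`, and
if it is the preferred one among the half-spaces with left end `h`. -/
def Visible [LE ι] (i : ι) (h : Γ) : Prop :=
  h ∈ H i ∧ (∀ j, ∀ k ∈ H j, k⁻¹ * h ∈ N j → k⁻¹ * (h * e i) ∉ N j) ∧
    ∀ j, h ∈ H j → N j ⊆ N i ∧ (N i ⊆ N j → i ≤ j)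

variable {H e N}

theorem mem_leftPart_mul {κ : Γ} (hκ : ∀ j, κ ∈ H j) (i : ι) (h x : Γ) :
    κ * x ∈ leftPart H N i (κ * h) ↔ x ∈ leftPart H N i h := by
  have e1 : ∀ k y : Γ, (κ * k)⁻¹ * (κ * y) = k⁻¹ * y := fun k y => by group
  simp only [leftPart, Set.mem_ofPred_eq, e1]
  refine and_congr_right fun _ => ⟨fun hx j k hk hkh => ?_, fun hx j k hk hkh => ?_⟩
  · simpa only [e1] using hx j (κ * k) (mul_mem (hκ j) hk) (by rwa [e1])
  · have e2 : ∀ y : Γ, k⁻¹ * (κ * y) = (κ⁻¹ * k)⁻¹ * y := fun y => by group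
    rw [e2] at hkh ⊢
    exact hx j _ (mul_mem (inv_mem (hκ j)) hk) hkh

theorem visible_mul [LE ι] {κ : Γ} (hκ : ∀ j, κ ∈ H j) {i : ι} {h : Γ} (hv : Visible H e N i h) :
    Visible H e N i (κ * h) := by
  obtain ⟨h1, h2, h3⟩ := hv
  refine ⟨mul_mem (hκ i) h1, fun j k hk hkh => ?_, fun j hj => h3 j ?_⟩
  · have e2 : ∀ y : Γ, k⁻¹ * (κ * y) = (κ⁻¹ * k)⁻¹ * y := fun y => by group
    rw [mul_assoc, e2]
    rw [e2] at hkh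
    exact h2 j _ (mul_mem (inv_mem (hκ j)) hk) hkh
  · simpa using mul_mem (inv_mem (hκ j)) hj

variable {ord : Γ → Ω}

theorem Cut.subset_iff {i j : ι} (Ci : Cut ord (H i) (e i) (N i)) (Cj : Cut ord (H j) (e j) (N j))
    {h : Γ} (hi : h ∈ H i) (hj : h ∈ H j) : N i ⊆ N j ↔ ord (h * e i) ≤ ord (h * e j) := by
  constructor
  · intro hs
    exact ((Cj.interval h hj _).1 (by simpa using hs Ci.mem)).2
  · intro hle x hx
    have h1 := (Ci.interval h hi (h * x)).1 (by simpa using hx)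
    simpa using (Cj.interval h hj (h * x)).2 ⟨h1.1, h1.2.trans hle⟩

theorem Cut.mem_mul_iff {H : Subgroup Γ} {e : Γ} {N : Set Γ} (C : Cut ord H e N) {x y : Γ}
    (hxy : x⁻¹ * y ∈ H) : x ∈ N ↔ y ∈ N := by
  constructor
  · intro h
    simpa using C.right x h _ hxy
  · intro h
    simpa using C.right y h _ (inv_mem hxy)

theorem leftPart_eq [Finite ι] (C : ∀ i, Cut ord (H i) (e i) (N i)) (i : ι) {h : Γ} (hi : h ∈ H i) :
    leftPart H N i h = {x | h⁻¹ * x ∈ N i} ∨ ∃ j, ∃ k ∈ H j, k⁻¹ * h ∈ N j ∧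
      leftPart H N i h = {x | h⁻¹ * x ∈ N i} \ {x | k⁻¹ * x ∈ N j} := by
  by_cases hJ : Nonempty {j // ∃ k ∈ H j, k⁻¹ * h ∈ N j}
  · choose k hk hkh using fun j : {j // ∃ k ∈ H j, k⁻¹ * h ∈ N j} => j.2
    obtain ⟨j, hj⟩ := Finite.exists_max fun j => ord (k j * e j)
    refine .inr ⟨j, k j, hk j, hkh j, ?_⟩
    ext x
    simp only [leftPart, Set.mem_ofPred_eq, Set.mem_sdiff]
    refine and_congr_right fun hx =>
      ⟨fun hx' => hx' _ _ (hk j) (hkh j), fun hx' j' k' hk' hkh' hx'' => ?_⟩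
    refine hx' (((C j).interval _ (hk j) x).2 ⟨?_, ?_⟩)
    · exact (((C j).interval _ (hk j) h).1 (hkh j)).1.trans (((C i).interval _ hi x).1 hx).1
    · have hu := (C j').unique h k' hk' _ (hk ⟨j', k', hk', hkh'⟩) hkh' (hkh ⟨j', k', hk', hkh'⟩)
      refine ((((C j').interval _ hk' x).1 hx'').2).trans ?_
      rw [hu]
      exact hj ⟨j', k', hk', hkh'⟩
  · left
    ext x
    simp only [leftPart, Set.mem_ofPred_eq, and_iff_left_iff_imp]
    exact fun _ j k hk hkh => (hJ ⟨j, k, hk, hkh⟩).elim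

theorem almostInvariant_leftPart [Finite ι] (C : ∀ i, Cut ord (H i) (e i) (N i)) (i : ι) {h : Γ}
    (hi : h ∈ H i) : AlmostInvariant (leftPart H N i h) := by
  rcases leftPart_eq C i hi with h1 | ⟨j, k, -, -, h1⟩ <;> rw [h1]
  · exact (C i).almostInvariant.translate h
  · exact ((C i).almostInvariant.translate h).diff ((C j).almostInvariant.translate k)

/-- A point lies in the left part of at most one visible half-space. -/
theorem Visible.unique [PartialOrder ι] (hord : Function.Injective ord)
    (C : ∀ i, Cut ord (H i) (e i) (N i)) {i j : ι} {h k x : Γ} (hi : Visible H e N i h)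
    (hj : Visible H e N j k) (hx : x ∈ leftPart H N i h) (hx' : x ∈ leftPart H N j k) :
    i = j ∧ h = k := by
  have aux : ∀ {i j : ι} {h k : Γ}, Visible H e N i h → Visible H e N j k →
      x ∈ leftPart H N i h → x ∈ leftPart H N j k → ord k ≤ ord h := by
    intro i j h k hi hj hx hx'
    by_contra! hlt
    have h1 := ((C i).interval h hi.1 x).1 hx.1
    have h2 := ((C j).interval k hj.1 x).1 hx'.1
    exact hx'.2 i h hi.1 (((C i).interval h hi.1 k).2 ⟨hlt, h2.1.le.trans h1.2⟩) hx.1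
  have hhk : h = k := hord ((aux hj hi hx' hx).antisymm (aux hi hj hx hx'))
  subst hhk
  have hij := hi.2.2 j hj.1
  have hji := hj.2.2 i hi.1
  exact ⟨(hij.2 hji.1).antisymm (hji.2 hij.1), rfl⟩

/-- If `g` moves cosets `t i H i` meeting pairwise to a family without common point `1`, then some
visible half-space contains a member of this family and is minimal with this property. -/
theorem exists_visible [Finite ι] [LinearOrder ι] (C : ∀ i, Cut ord (H i) (e i) (N i)) {t : ι → Γ}
    {y : ι → ι → Γ} (hy : ∀ i j, (t i)⁻¹ * y i j ∈ H i ∧ (t j)⁻¹ * y i j ∈ H j)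
    {i₀ : ι} (ht : t i₀ ∉ H i₀) :
    ∃ i h, Visible H e N i h ∧ ∀ j, h⁻¹ * y i j ∈ N i ∧
      ∀ k ∈ H j, k⁻¹ * h ∈ N j → k⁻¹ * y i j ∉ N j := by
  have transl : ∀ i (h x x' : Γ), x⁻¹ * x' ∈ H i → (h⁻¹ * x ∈ N i ↔ h⁻¹ * x' ∈ N i) :=
    fun i h x x' hx => (C i).mem_mul_iff (by simpa [mul_assoc] using hx)
  let I := {i // ∃ h ∈ H i, h⁻¹ * t i ∈ N i}
  have : Nonempty I := ⟨⟨i₀, (C i₀).cover _ ht⟩⟩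
  choose h hh hht using fun i : I => i.2
  obtain ⟨i, hi⟩ := Finite.exists_min fun i : I =>
    toLex (ord (h i), toLex (OrderDual.toDual (ord (h i * e i)), i.1))
  have hi' : ∀ j, ∀ k ∈ H j, k⁻¹ * t j ∈ N j → ord (h i) ≤ ord k ∧ (ord k ≤ ord (h i) →
      ord (k * e j) ≤ ord (h i * e i) ∧ (ord (h i * e i) ≤ ord (k * e j) → i.1 ≤ j)) := by
    intro j k hk hkt
    have h1 := hi ⟨j, k, hk, hkt⟩
    rw [(C j).unique _ _ (hh ⟨j, k, hk, hkt⟩) _ hk (hht ⟨j, k, hk, hkt⟩) hkt] at h1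
    simp only [Prod.Lex.toLex_le_toLex, OrderDual.toDual_lt_toDual, OrderDual.toDual_inj] at h1
    grind
  have hiy : ∀ j, (h i)⁻¹ * y i j ∈ N i := fun j => (transl i (h i) _ _ (hy i j).1).1 (hht i)
  have lt_of : ∀ j, ∀ k ∈ H j, k⁻¹ * h i ∈ N j → k⁻¹ * y i j ∉ N j := by
    intro j k hk hkh hky
    exact ((hi' j k hk ((transl j k _ _ (hy i j).2).2 hky)).1).not_gt
      (((C j).interval k hk _).1 hkh).1
  refine ⟨i, h i, ⟨hh i, fun j k hk hkh hke => lt_of j k hk hkh ?_, fun j hj => ?_⟩,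
    fun j => ⟨hiy j, lt_of j⟩⟩
  · have h1 := ((C i).interval _ (hh i) _).1 (hiy j)
    have h2 := ((C j).interval k hk _).1 hkh
    have h3 := ((C j).interval k hk _).1 hke
    exact ((C j).interval k hk _).2 ⟨h2.1.trans h1.1, h1.2.trans h3.2⟩
  · have key : N i ⊆ N j → ord (h i * e j) ≤ ord (h i * e i) ∧
        (ord (h i * e i) ≤ ord (h i * e j) → i.1 ≤ j) := fun hs =>
      (hi' j (h i) hj ((transl j _ _ _ (hy i j).2).2 (hs (hiy j)))).2 le_rfl
    rw [(C i).subset_iff (C j) (hh i) hj] at key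
    rw [(C j).subset_iff (C i) hj (hh i), (C i).subset_iff (C j) (hh i) hj]
    refine ⟨?_, fun hle => (key hle).2 hle⟩
    rcases le_total (ord (h i * e i)) (ord (h i * e j)) with hle | hle
    · exact (key hle).1
    · exact hle


theorem exists_index [Finite ι] (C : ∀ i, Cut ord (H i) (e i) (N i)) (i : ι) {h : Γ}
    (hi : h ∈ H i) : ∃ j, ∀ x, (h⁻¹ * x ∈ N i ∧ ∀ k ∈ H j, k⁻¹ * h ∈ N j → k⁻¹ * x ∉ N j) →
      x ∈ leftPart H N i h := by
  rcases leftPart_eq C i hi with h1 | ⟨j, k, hk, hkh, h1⟩ <;> rw [h1]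
  · exact ⟨i, fun x hx => hx.1⟩
  · exact ⟨j, fun x hx => ⟨hx.1, hx.2 k hk hkh⟩⟩

variable (H e N) in
/-- Visible half-spaces up to translation by the intersection of the subgroups. -/
def visibleSetoid [LE ι] : Setoid {p : ι × Γ // Visible H e N p.1 p.2} where
  r p q := p.1.1 = q.1.1 ∧ q.1.2 * p.1.2⁻¹ ∈ ⨅ i, H i
  iseqv :=
    { refl := fun p => ⟨rfl, by simp⟩
      symm := fun h => ⟨h.1.symm, by simpa using inv_mem h.2⟩
      trans := fun h h' => ⟨h.1.trans h'.1, by simpa using mul_mem h'.2 h.2⟩ }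

theorem finite_quotient_visible [Finite ι] [LE ι] (C : ∀ i, Cut ord (H i) (e i) (N i)) :
    Finite (Quotient (visibleSetoid H e N)) := by
  let B : ι → Set Γ := fun j => insert 1 (⋃ i, {b | ¬(b * e i ∈ N j ↔ b ∈ N j)})
  have hB : ∀ j, Finite (B j) := fun j =>
    ((Set.finite_iUnion fun i => (C j).almostInvariant (e i)).insert 1).to_subtype
  have hcode : ∀ p : {p : ι × Γ // Visible H e N p.1 p.2}, ∀ j, ∃ k ∈ H j, k⁻¹ * p.1.2 ∈ B j := by
    intro p j
    by_cases hp : p.1.2 ∈ H j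
    · exact ⟨_, hp, by simp [B]⟩
    · obtain ⟨k, hk, hkp⟩ := (C j).cover _ hp
      refine ⟨k, hk, .inr (Set.mem_iUnion.2 ⟨p.1.1, ?_⟩)⟩
      have := p.2.2.1 j k hk hkp
      simp only [Set.mem_ofPred_eq, mul_assoc]
      tauto
  choose k hk hkB using hcode
  refine Finite.of_injective (β := ι × ∀ j, B j)
    (fun q => (q.out.1.1, fun j => ⟨_, hkB q.out j⟩)) ?_
  intro q q' hqq
  simp only [Prod.mk.injEq] at hqq
  rw [← q.out_eq, ← q'.out_eq]
  refine Quotient.sound ⟨hqq.1, Subgroup.mem_iInf.2 fun j => ?_⟩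
  have hj := congrArg Subtype.val (congrFun hqq.2 j)
  simp only at hj
  have : q'.out.1.2 * q.out.1.2⁻¹ = k q'.out j * (k q.out j)⁻¹ := by
    rw [inv_mul_eq_iff_eq_mul] at hj
    rw [hj]
    group
  rw [this]
  exact mul_mem (hk _ _) (inv_mem (hk _ _))

/-- A Helly property: cosets of the subgroups `H i` that intersect pairwise have a common point. -/
theorem exists_common [Finite ι] [LinearOrder ι] (hord : Function.Injective ord)
    (C : ∀ i, Cut ord (H i) (e i) (N i)) {S : Set Γ} (hS : Subgroup.closure S = ⊤)
    (hinv : ∀ s ∈ S, s * s = 1) (t : ι → Γ) (y : ι → ι → Γ)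
    (hy : ∀ i j, (t i)⁻¹ * y i j ∈ H i ∧ (t j)⁻¹ * y i j ∈ H j) :
    ∃ z, ∀ i, (t i)⁻¹ * z ∈ H i := by
  classical
  by_contra! hno
  have := finite_quotient_visible C
  have := Fintype.ofFinite (Quotient (visibleSetoid H e N))
  set R := Quotient (visibleSetoid H e N) with hR
  let F : R → Set Γ := fun r => leftPart H N r.out.1.1 r.out.1.2
  have hF : ∀ r, AlmostInvariant (F r) := fun r => almostInvariant_leftPart C _ r.out.2.1
  choose J hJ using fun r : R => exists_index C r.out.1.1 r.out.2.1
  let u : R → Γ := fun r => y r.out.1.1 (J r)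
  let coset : Γ → Quotient (QuotientGroup.rightRel (⨅ i, H i)) := Quotient.mk _
  have coset_eq : ∀ x x', coset x = coset x' ↔ x' * x⁻¹ ∈ ⨅ i, H i := fun x x' => by
    rw [Quotient.eq, QuotientGroup.rightRel_apply]
  have entering : ∀ c, ∃ a, coset a = c ∧ ∃ r, a * u r ∈ F r := by
    intro c
    obtain ⟨g, rfl⟩ := Quotient.exists_rep c
    obtain ⟨i₀, hi₀⟩ := hno g⁻¹
    obtain ⟨i, h, hv, hih⟩ := exists_visible C (t := fun i => g * t i) (y := fun i j => g * y i j)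
      (fun i j => by simpa [mul_assoc] using hy i j) (i₀ := i₀)
      (fun hm => hi₀ (by simpa using inv_mem hm))
    let r : R := Quotient.mk _ ⟨(i, h), hv⟩
    obtain ⟨h1, h2⟩ : i = r.out.1.1 ∧ r.out.1.2 * h⁻¹ ∈ ⨅ i, H i :=
      Quotient.exact (r.out_eq.symm)
    set κ := r.out.1.2 * h⁻¹ with hκ
    refine ⟨κ * g, (((coset_eq _ _).2 (by simpa using inv_mem h2))), r, ?_⟩
    refine hJ r _ ?_
    have h3 : r.out.1.2 = κ * h := by simp [hκ]
    have h4 := hih (J r)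
    simp only [u, h3, ← h1]
    refine ⟨by convert h4.1 using 1; group, fun k hk hkh => ?_⟩
    have h5 := h4.2 (κ⁻¹ * k) (mul_mem (inv_mem (Subgroup.mem_iInf.1 h2 _)) hk)
      (by convert hkh using 1; group)
    convert h5 using 2
    group
  have leaving : ∀ g r g' r', g ∈ F r → g' ∈ F r' → coset g = coset g' → g = g' ∧ r = r' := by
    intro g r g' r' hg hg' hgg
    rw [coset_eq] at hgg
    have h1 := Subgroup.mem_iInf.1 hgg
    have h2 := (mem_leftPart_mul h1 r.out.1.1 r.out.1.2 g).2 hg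
    rw [inv_mul_cancel_right] at h2
    have h3 := (visible_mul h1 r.out.2).unique hord C r'.out.2 h2 hg'
    have h4 : r = r' := by
      rw [← r.out_eq, ← r'.out_eq]
      exact Quotient.sound ⟨h3.1, by rw [← h3.2]; simpa using hgg⟩
    subst h4
    exact ⟨by simpa [mul_inv_eq_one, eq_comm] using h3.2, rfl⟩
  have not_one : ∀ g r, g ∈ F r → coset g ≠ coset 1 := by
    intro g r hg h1
    rw [eq_comm, coset_eq, inv_one, mul_one] at h1
    exact (C _).disjoint _ hg.1 (mul_mem (inv_mem r.out.2.1) (Subgroup.mem_iInf.1 h1 _))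
  choose a ha ra hra using entering
  let S₀ : Finset Γ := Finset.univ.biUnion fun r => ((hF r).finite_support (u r)).toFinset
  let S₁ : Finset (Quotient (QuotientGroup.rightRel (⨅ i, H i))) :=
    insert (coset 1) (S₀.image coset)
  let S₂ : Finset Γ := S₀ ∪ S₁.image a
  have hS₂ : ∀ g ∈ S₂, coset g ∈ S₁ := by
    intro g hg
    rcases Finset.mem_union.1 hg with hg | hg
    · exact Finset.mem_insert_of_mem (Finset.mem_image_of_mem _ hg)
    · obtain ⟨c, hc, rfl⟩ := Finset.mem_image.1 hg
      rwa [ha]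
  have bal : ∀ r, ∑ g ∈ S₂, (if g * u r ∈ F r then 1 else 0 : ℤ) =
      ∑ g ∈ S₂, (if g ∈ F r then 1 else 0 : ℤ) := by
    intro r
    rw [← sub_eq_zero, ← Finset.sum_sub_distrib,
      ← finsum_eq_sum_of_support_subset _ (s := S₂) ?_]
    · exact (hF r).finsum_eq_zero hS hinv (u r)
    · intro g hg
      refine Finset.mem_union_left _ (Finset.mem_biUnion.2 ⟨r, Finset.mem_univ _, ?_⟩)
      exact (Set.Finite.mem_toFinset _).2 hg
  have card_eq : ((Finset.univ ×ˢ S₂).filter fun p : R × Γ => p.2 * u p.1 ∈ F p.1).card =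
      ((Finset.univ ×ˢ S₂).filter fun p : R × Γ => p.2 ∈ F p.1).card := by
    zify
    rw [Finset.card_filter, Finset.card_filter]
    push_cast
    rw [Finset.sum_product, Finset.sum_product]
    exact Finset.sum_congr rfl fun r _ => bal r
  have card_le : S₁.card ≤
      ((Finset.univ ×ˢ S₂).filter fun p : R × Γ => p.2 * u p.1 ∈ F p.1).card := by
    refine Finset.card_le_card_of_injOn (fun c => (ra c, a c)) (fun c hc => ?_) ?_
    · simp only [Finset.coe_filter, Finset.mem_product, Finset.mem_univ, true_and,
        Set.mem_ofPred_eq]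
      exact ⟨Finset.mem_union_right _ (Finset.mem_image_of_mem _ hc), hra c⟩
    · intro c _ c' _ hcc
      rw [← ha c, ← ha c', (Prod.mk.inj hcc).2]
  have card_lt : ((Finset.univ ×ˢ S₂).filter fun p : R × Γ => p.2 ∈ F p.1).card ≤
      (S₁.erase (coset 1)).card := by
    refine Finset.card_le_card_of_injOn (fun p => coset p.2) (fun p hp => ?_) ?_
    · simp only [Finset.coe_filter, Finset.mem_product, Finset.mem_univ, true_and,
        Set.mem_ofPred_eq] at hp
      exact Finset.mem_erase.2 ⟨not_one _ _ hp.2, hS₂ _ hp.1⟩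
    · intro p hp q hq hpq
      simp only [Finset.coe_filter, Finset.mem_product, Finset.mem_univ, true_and,
        Set.mem_ofPred_eq] at hp hq
      obtain ⟨h1, h2⟩ := leaving _ _ _ _ hp.2 hq.2 hpq
      exact Prod.ext h2 h1
  have : (S₁.erase (coset 1)).card < S₁.card :=
    Finset.card_erase_lt_of_mem (Finset.mem_insert_self _ _)
  omega

end Helly

section Line

/-- A line ordered lexicographically, on which the generators `hat i` below act by increasing
bijections. -/
abbrev Line : Type := ℤ ×ₗ Lex (ℕ → Fin 4)

namespace Line

/-- The point with the given coordinates. -/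
def mk (n : ℤ) (l : ℕ → Fin 4) : Line := toLex (n, toLex l)

/-- The integer coordinate. -/
def height (p : Line) : ℤ := (ofLex p).1

/-- The sequence coordinate. -/
def digits (p : Line) : ℕ → Fin 4 := ofLex (ofLex p).2

@[simp] theorem height_mk (n : ℤ) (l : ℕ → Fin 4) : (mk n l).height = n := rfl

@[simp] theorem digits_mk (n : ℤ) (l : ℕ → Fin 4) : (mk n l).digits = l := rfl

@[simp] theorem mk_height_digits (p : Line) : mk p.height p.digits = p := rfl

theorem ext {p q : Line} (h : p.height = q.height) (h' : ∀ k, p.digits k = q.digits k) :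
    p = q := by
  rw [← mk_height_digits p, ← mk_height_digits q, h, funext h']

theorem lt_iff {p q : Line} : p < q ↔ p.height < q.height ∨ p.height = q.height ∧
    ∃ k, (∀ m < k, p.digits m = q.digits m) ∧ p.digits k < q.digits k :=
  Prod.Lex.lt_iff

theorem height_mono {p q : Line} (h : p ≤ q) : p.height ≤ q.height := by
  rcases Prod.Lex.le_iff.1 h with h | h
  · exact h.le
  · exact h.1.le

/-- Prepend a digit to a sequence. -/
def cons (a : Fin 4) (l : ℕ → Fin 4) : ℕ → Fin 4
  | 0 => a
  | k + 1 => l k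

/-- The translation by five units. -/
def shift (m : ℤ) (p : Line) : Line := mk (p.height + 5 * m) p.digits

/-- The increasing bijection attached to the `i`-th generator. -/
def flip (i : Fin 4) (p : Line) : Line :=
  if (i + 1 - p.height) % 5 = 0 then mk (p.height + p.digits 0 + 1) fun k => p.digits (k + 1)
  else mk (p.height + (i + 1 - p.height) % 5)
    (cons (Fin.ofNat 4 (4 - (i + 1 - p.height) % 5).toNat) p.digits)

theorem flip_flip (i : Fin 4) (p : Line) : flip i (flip i p) = shift 1 p := by
  have hi := i.isLt
  by_cases h : (i + 1 - p.height) % 5 = 0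
  · have h0 := (p.digits 0).isLt
    have h1 : flip i p = mk (p.height + p.digits 0 + 1) fun k => p.digits (k + 1) := if_pos h
    have h2 : ((i : ℤ) + 1 - (p.height + p.digits 0 + 1)) % 5 = 4 - (p.digits 0 : ℕ) := by omega
    rw [h1, flip, height_mk, digits_mk, h2, if_neg (by omega)]
    refine ext ?_ fun k => ?_
    · simp [shift]
      omega
    · cases k with
      | zero => simp [shift, cons]
      | succ k => simp [shift, cons]
  · have h1 : flip i p = _ := if_neg h
    have h2 : ((i : ℤ) + 1 - (p.height + (i + 1 - p.height) % 5)) % 5 = 0 := by omega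
    rw [h1, flip, height_mk, digits_mk, if_pos h2]
    refine ext ?_ fun k => ?_
    · simp [shift, cons]
      omega
    · simp [shift, cons]

theorem strictMono_flip (i : Fin 4) : StrictMono (flip i) := by
  intro p q hpq
  have hi := i.isLt
  have hp0 := (p.digits 0).isLt
  have hq0 := (q.digits 0).isLt
  rw [lt_iff] at hpq
  by_cases hp : (i + 1 - p.height) % 5 = 0 <;> by_cases hq : (i + 1 - q.height) % 5 = 0
  · simp only [flip, if_pos hp, if_pos hq, lt_iff, height_mk, digits_mk]
    rcases hpq with hpq | ⟨hpq, k, hk, hk'⟩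
    · omega
    · cases k with
      | zero => rw [Fin.lt_def] at hk'; omega
      | succ k =>
        right
        refine ⟨by rw [hpq, hk 0 (by omega)], k, fun m hm => hk _ (by omega), hk'⟩
  · simp only [flip, if_pos hp, if_neg hq, lt_iff, height_mk, digits_mk]
    omega
  · simp only [flip, if_neg hp, if_pos hq, lt_iff, height_mk, digits_mk]
    omega
  · simp only [flip, if_neg hp, if_neg hq, lt_iff, height_mk, digits_mk]
    rcases hpq with hpq | ⟨hpq, k, hk, hk'⟩
    · by_cases hlt : p.height + (i + 1 - p.height) % 5 < q.height + (i + 1 - q.height) % 5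
      · exact .inl hlt
      · refine .inr ⟨by omega, 0, by simp, ?_⟩
        simp only [cons, Fin.lt_def, Fin.val_ofNat]
        omega
    · refine .inr ⟨by rw [hpq], k + 1, fun m hm => ?_, hk'⟩
      cases m with
      | zero => simp [cons, hpq]
      | succ m => exact hk m (by omega)

theorem shift_shift (m n : ℤ) (p : Line) : shift m (shift n p) = shift (n + m) p := by
  simp only [shift, height_mk, digits_mk]
  congr 1
  ring

@[simp] theorem shift_zero (p : Line) : shift 0 p = p := by simp [shift]

/-- `flip i` as an order automorphism. -/
noncomputable def flipIso (i : Fin 4) : Line ≃o Line :=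
  (strictMono_flip i).orderIsoOfRightInverse _ (fun p => flip i (shift (-1) p)) fun p => by
    rw [flip_flip, shift_shift]
    simp

@[simp] theorem flipIso_apply (i : Fin 4) (p : Line) : flipIso i p = flip i p := rfl

theorem height_flip {i : Fin 4} {p : Line} (h : (i + 1 - p.height) % 5 ≠ 0) :
    (flip i p).height = p.height + (i + 1 - p.height) % 5 := by
  rw [flip, if_neg h, height_mk]

end Line
end Line

section Cover

/-- The relators identifying the squares of the four generators. -/
def hatRels : Set (FreeGroup (Fin 4)) :=
  {r | ∃ i j : Fin 4, r = FreeGroup.of i * FreeGroup.of i * (FreeGroup.of j * FreeGroup.of j)⁻¹}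

/-- The group generated by four elements with the same square: a central extension of the free
product of four groups of order two. -/
abbrev Hat : Type := PresentedGroup hatRels

/-- The generators of `Hat`. -/
def hat (i : Fin 4) : Hat := PresentedGroup.of i

/-- The common square of the generators of `Hat`. -/
def center : Hat := hat 0 * hat 0

theorem hat_mul_self (i : Fin 4) : hat i * hat i = center :=
  PresentedGroup.mk_eq_mk_of_mul_inv_mem ⟨i, 0, rfl⟩

namespace Hat

/-- The universal property of `Hat`. -/
def lift {K : Type*} [Group K] (f : Fin 4 → K) (hf : ∀ i j, f i * f i = f j * f j) : Hat →* K :=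
  PresentedGroup.toGroup (f := f) (by
    rintro _ ⟨i, j, rfl⟩
    simp [hf i j])

@[simp] theorem lift_hat {K : Type*} [Group K] (f : Fin 4 → K)
    (hf : ∀ i j, f i * f i = f j * f j) (i : Fin 4) : lift f hf (hat i) = f i :=
  PresentedGroup.toGroup.of _

theorem hom_ext {K : Type*} [Group K] {f g : Hat →* K} (h : ∀ i, f (hat i) = g (hat i)) : f = g :=
  PresentedGroup.ext h

theorem closure_hat : Subgroup.closure (Set.range hat) = ⊤ :=
  PresentedGroup.closure_range_of hatRels

theorem commute_center (x : Hat) : center * x = x * center := by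
  have hx : x ∈ Subgroup.closure (Set.range hat) := closure_hat ▸ Subgroup.mem_top x
  induction hx using Subgroup.closure_induction with
  | mem x hx =>
    obtain ⟨i, rfl⟩ := hx
    rw [← hat_mul_self i, mul_assoc]
  | one => simp
  | mul x y _ _ hx hy => rw [← mul_assoc, hx, mul_assoc, hy, mul_assoc]
  | inv x _ hx => exact (show Commute center x from hx).inv_right.eq

theorem hat_inv (i : Fin 4) : (hat i)⁻¹ = center⁻¹ * hat i := by
  rw [eq_inv_mul_iff_mul_eq, ← hat_mul_self i, mul_inv_cancel_right]

/-- The action of `Hat` on the line. -/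
noncomputable def act : Hat →* (Line ≃o Line) :=
  lift Line.flipIso fun i j => by
    ext p
    simp only [RelIso.mul_apply, Line.flipIso_apply, Line.flip_flip]

@[simp] theorem act_hat (i : Fin 4) (p : Line) : act (hat i) p = Line.flip i p := by
  simp [act]

theorem act_center (p : Line) : act center p = Line.shift 1 p := by
  simp [center, RelIso.mul_apply, Line.flip_flip]

theorem act_center_zpow (m : ℤ) (p : Line) : act (center ^ m) p = Line.shift m p := by
  have key : ∀ (m : ℤ) (p : Line), act (center ^ m) (act center p) = act (center ^ (m + 1)) p :=
    fun m p => by rw [zpow_add_one, map_mul, RelIso.mul_apply]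
  induction m generalizing p with
  | zero => simp
  | succ m ih => rw [← key, ih, act_center, Line.shift_shift, add_comm]
  | pred m ih =>
    have h := key (-m - 1) (Line.shift (-1) p)
    rw [act_center, Line.shift_shift, sub_add_cancel, ih, Line.shift_shift] at h
    simp only [neg_add_cancel, Line.shift_zero] at h
    rw [h]
    congr 1
    ring

theorem act_hat_inv (i : Fin 4) (p : Line) :
    act (hat i)⁻¹ p = Line.shift (-1) (Line.flip i p) := by
  rw [hat_inv, map_mul, RelIso.mul_apply, act_hat, ← zpow_neg_one, act_center_zpow]

/-- The base point of the line. -/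
def origin : Line := Line.mk 0 fun _ => 3

@[simp] theorem height_origin : origin.height = 0 := rfl

/-- The leading letter of a word in the four generators, or zero for the empty word. -/
def head : List (Fin 4) → ℤ
  | [] => 0
  | i :: _ => i + 1

theorem head_cons (i : Fin 4) (l : List (Fin 4)) : head (i :: l) = i + 1 := rfl

theorem head_nonneg (l : List (Fin 4)) : 0 ≤ head l := by
  cases l <;> simp [head]
  omega

theorem head_lt (l : List (Fin 4)) : head l < 5 := by
  cases l <;> simp [head]
  omega

/-- The lift of a word with value in the fundamental domain. -/
def bl : List (Fin 4) → Hat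
  | [] => 1
  | i :: l => (if (i : ℤ) + 1 < head l then (hat i)⁻¹ else hat i) * bl l

theorem bl_cons (i : Fin 4) (l : List (Fin 4)) :
    bl (i :: l) = (if (i : ℤ) + 1 < head l then (hat i)⁻¹ else hat i) * bl l := rfl

theorem isChain_cons_head {i : Fin 4} {l : List (Fin 4)} :
    (i :: l).IsChain (· ≠ ·) ↔ (i : ℤ) + 1 ≠ head l ∧ l.IsChain (· ≠ ·) := by
  cases l with
  | nil => simp [head]; omega
  | cons j l => simp [head, List.isChain_cons_cons, Fin.ext_iff]

theorem height_bl {l : List (Fin 4)} (hl : l.IsChain (· ≠ ·)) :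
    (act (bl l) origin).height = head l := by
  induction l with
  | nil => simp [bl, head, origin]
  | cons i l ih =>
    have h1 := head_nonneg l
    have h2 := head_lt l
    rw [isChain_cons_head] at hl
    replace ih := ih hl.2
    have hne : ((i : ℤ) + 1 - (act (bl l) origin).height) % 5 ≠ 0 := by omega
    have h3 := Line.height_flip hne
    rw [bl_cons]
    split_ifs with h
    · rw [map_mul, RelIso.mul_apply, act_hat_inv, Line.shift, Line.height_mk, h3, ih]
      rw [head_cons]
      omega
    · rw [map_mul, RelIso.mul_apply, act_hat, h3, ih]
      rw [head_cons]
      omega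

theorem exists_eq_bl (x : Hat) : ∃ (m : ℤ) (l : List (Fin 4)),
    l.IsChain (· ≠ ·) ∧ x = center ^ m * bl l := by
  have hmul : ∀ i (x : Hat), (∃ (m : ℤ) (l : List (Fin 4)),
      l.IsChain (· ≠ ·) ∧ x = center ^ m * bl l) → ∃ (m : ℤ) (l : List (Fin 4)),
      l.IsChain (· ≠ ·) ∧ hat i * x = center ^ m * bl l := by
    rintro i x ⟨m, l, hl, rfl⟩
    have hc : ∀ (m : ℤ) (y : Hat), y * center ^ m = center ^ m * y := fun m y =>
      ((show Commute center y from commute_center y).zpow_left m).eq.symm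
    by_cases h : (i : ℤ) + 1 = head l
    · cases l with
      | nil => simp [head] at h; omega
      | cons j l =>
        obtain rfl : i = j := by simp [head] at h; omega
        rw [bl_cons]
        split_ifs
        · exact ⟨m, l, hl.tail, by rw [← mul_assoc, hc, mul_assoc, mul_inv_cancel_left]⟩
        · refine ⟨m + 1, l, hl.tail, ?_⟩
          rw [← mul_assoc, hc, mul_assoc, ← mul_assoc (hat i), hat_mul_self, zpow_add_one,
            mul_assoc]
    · by_cases h' : (i : ℤ) + 1 < head l
      · refine ⟨m + 1, i :: l, isChain_cons_head.2 ⟨h, hl⟩, ?_⟩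
        rw [bl, if_pos h', ← mul_assoc, hc, zpow_add_one, hat_inv]
        group
      · refine ⟨m, i :: l, isChain_cons_head.2 ⟨h, hl⟩, ?_⟩
        rw [bl, if_neg h', ← mul_assoc, hc, mul_assoc]
  have hx : x ∈ Subgroup.closure (Set.range hat) := closure_hat ▸ Subgroup.mem_top x
  induction hx using Subgroup.closure_induction_left with
  | one => exact ⟨0, [], by simp, by simp [bl]⟩
  | mul_left y hy x _ ih =>
    obtain ⟨i, rfl⟩ := hy
    exact hmul i x ih
  | inv_mul_cancel y hy x _ ih =>
    obtain ⟨i, rfl⟩ := hy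
    obtain ⟨m, l, hl, h⟩ := hmul i x ih
    refine ⟨m - 1, l, hl, ?_⟩
    rw [hat_inv, mul_assoc, h, zpow_sub_one, ← mul_assoc]
    congr 1
    group

theorem height_act (m : ℤ) {l : List (Fin 4)} (hl : l.IsChain (· ≠ ·)) :
    (act (center ^ m * bl l) origin).height = head l + 5 * m := by
  rw [map_mul, RelIso.mul_apply, act_center_zpow, Line.shift, Line.height_mk, height_bl hl]

/-- The elements moving the origin into the fundamental domain of the centre. -/
def Low (x : Hat) : Prop := 0 ≤ (act x origin).height ∧ (act x origin).height < 5

theorem low_iff {x : Hat} : Low x ↔ ∃ l : List (Fin 4), l.IsChain (· ≠ ·) ∧ x = bl l := by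
  constructor
  · intro h
    obtain ⟨m, l, hl, rfl⟩ := exists_eq_bl x
    have h1 := head_nonneg l
    have h2 := head_lt l
    simp only [Low, height_act m hl] at h
    obtain rfl : m = 0 := by omega
    exact ⟨l, hl, by simp⟩
  · rintro ⟨l, hl, rfl⟩
    simp only [Low, height_bl hl]
    exact ⟨head_nonneg l, head_lt l⟩

theorem eq_one_of_act_origin {x : Hat} (h : act x origin = origin) : x = 1 := by
  obtain ⟨l, hl, rfl⟩ := low_iff.1 (show Low x by simp [Low, h])
  have h1 := height_bl hl
  rw [h] at h1
  cases l with
  | nil => rfl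
  | cons i l => simp [head, origin] at h1; omega

theorem low_iff_le_lt {x : Hat} :
    Low x ↔ origin ≤ act x origin ∧ act x origin < act center origin := by
  have h0 : (act center origin).height = 5 := by simp [act_center, Line.shift, origin]
  have h00 : origin.height = 0 := rfl
  obtain ⟨m, l, hl, rfl⟩ := exists_eq_bl x
  have h1 := head_nonneg l
  have h2 := head_lt l
  have h3 := height_act m hl
  constructor
  · rintro ⟨h4, h5⟩
    refine ⟨?_, Line.lt_iff.2 (by omega)⟩
    cases l with
    | nil =>
      simp only [head] at h3 h4 h5
      obtain rfl : m = 0 := by omega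
      simp [bl]
    | cons i l =>
      simp only [head] at *
      exact (Line.lt_iff.2 (by omega)).le
  · rintro ⟨h4, h5⟩
    have h6 := Line.height_mono h4
    refine ⟨by omega, ?_⟩
    have h7 := Line.height_mono h5.le
    by_contra h8
    cases l with
    | nil =>
      simp only [head] at *
      obtain rfl : m = 1 := by omega
      simp [bl] at h5
    | cons i l =>
      simp only [head] at *
      omega

end Hat
end Cover

section Positive

namespace Hat

/-- Elements generating the monoid of elements that move the origin to the right. -/
def eps : Fin 4 → Hat
  | 0 => hat 0 * (hat 1)⁻¹ * (hat 2)⁻¹ * (hat 3)⁻¹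
  | 1 => hat 1 * (hat 2)⁻¹ * (hat 3)⁻¹
  | 2 => hat 2 * (hat 3)⁻¹
  | 3 => hat 3

/-- The monoid of elements that move the origin to the right. -/
def Pos : Submonoid Hat := Submonoid.closure (Set.range eps)

theorem eps_mem (i : Fin 4) : eps i ∈ Pos := Submonoid.subset_closure ⟨i, rfl⟩

theorem height_act_hat_inv {i : Fin 4} {p : Line} (h : (i + 1 - p.height) % 5 ≠ 0) :
    (act (hat i)⁻¹ p).height = p.height + (i + 1 - p.height) % 5 - 5 := by
  rw [act_hat_inv, Line.shift, Line.height_mk, Line.height_flip h]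
  ring

theorem origin_le_eps (i : Fin 4) : origin ≤ act (eps i) origin := by
  refine (Line.lt_iff.2 (.inl ?_)).le
  have h3 : (act (hat 3)⁻¹ origin).height = -1 := by
    rw [height_act_hat_inv] <;> simp
  have h2 : (act (hat 2)⁻¹ (act (hat 3)⁻¹ origin)).height = -2 := by
    rw [height_act_hat_inv] <;> simp [-map_inv, h3]
  have h1 : (act (hat 1)⁻¹ (act (hat 2)⁻¹ (act (hat 3)⁻¹ origin))).height = -3 := by
    rw [height_act_hat_inv] <;> simp [-map_inv, h2]
  fin_cases i <;> simp only [eps, map_mul, RelIso.mul_apply, act_hat] <;>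
    rw [Line.height_flip] <;> simp [-map_inv, h1, h2, h3]

theorem origin_le_of_mem {x : Hat} (hx : x ∈ Pos) : origin ≤ act x origin := by
  induction hx using Submonoid.closure_induction with
  | mem x hx =>
    obtain ⟨i, rfl⟩ := hx
    exact origin_le_eps i
  | one => simp
  | mul x y _ _ hx hy =>
    rw [map_mul, RelIso.mul_apply]
    exact hx.trans ((act x).monotone hy)

theorem hat_three_mem : hat 3 ∈ Pos := eps_mem 3

theorem hat_two_mem : hat 2 ∈ Pos := by
  have h : hat 2 = eps 2 * hat 3 := by simp only [eps]; group
  rw [h]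
  exact mul_mem (eps_mem 2) hat_three_mem

theorem hat_one_mem : hat 1 ∈ Pos := by
  have h : hat 1 = eps 1 * hat 3 * hat 2 := by simp only [eps]; group
  rw [h]
  exact mul_mem (mul_mem (eps_mem 1) hat_three_mem) hat_two_mem

theorem hat_mem (i : Fin 4) : hat i ∈ Pos := by
  fin_cases i
  · have h : hat 0 = eps 0 * hat 3 * hat 2 * hat 1 := by simp only [eps]; group
    simp only [Fin.reduceFinMk]
    rw [h]
    exact mul_mem (mul_mem (mul_mem (eps_mem 0) hat_three_mem) hat_two_mem) hat_one_mem
  · exact hat_one_mem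
  · exact hat_two_mem
  · exact hat_three_mem

theorem center_mem : center ∈ Pos := mul_mem (hat_mem 0) (hat_mem 0)

theorem hat_inv_mul_hat_inv (i j : Fin 4) : (hat i)⁻¹ * (hat i)⁻¹ = (hat j)⁻¹ * (hat j)⁻¹ := by
  rw [← mul_inv_rev, ← mul_inv_rev, hat_mul_self, hat_mul_self]

theorem inv_conj (i : Fin 4) (x : Hat) : (hat i)⁻¹ * x * hat i = hat i * x * (hat i)⁻¹ := by
  have h : Commute center⁻¹ (hat i * x) :=
    (show Commute center (hat i * x) from commute_center _).inv_left
  rw [hat_inv, mul_assoc _ _ x, h.eq, mul_assoc]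

theorem inv_mul_hat (i j : Fin 4) : (hat i)⁻¹ * hat j = hat i * (hat j)⁻¹ := by
  rw [eq_mul_inv_iff_mul_eq, mul_assoc, inv_mul_eq_iff_eq_mul, hat_mul_self, hat_mul_self]

theorem eps_inv_mul_hat_mem (i : Fin 4) : (eps i)⁻¹ * hat i ∈ Pos := by
  have h3 := hat_mem 3
  have h2 := hat_mem 2
  have h1 := hat_mem 1
  fin_cases i <;> simp only [eps, Fin.reduceFinMk]
  · convert mul_mem (mul_mem h3 h2) h1 using 1
    group
  · convert mul_mem h3 h2 using 1
    group
  · convert h3 using 1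
    group
  · simp

theorem eps_inv_mul_hat_inv_mem {i j : Fin 4} (hij : i < j) :
    (eps i)⁻¹ * (hat i)⁻¹ * eps j ∈ Pos := by
  have hi : ∀ i, (eps i)⁻¹ * (hat i)⁻¹ =
      ((eps i)⁻¹ * hat i) * ((hat j)⁻¹ * (hat j)⁻¹) := fun i => by
    rw [← hat_inv_mul_hat_inv i j]
    group
  rw [hi]
  fin_cases i <;> fin_cases j <;> simp [Fin.lt_def] at hij <;> simp only [Fin.reduceFinMk]
  · convert one_mem Pos using 1
    simp only [eps]
    group
  · convert mul_mem (mul_mem (hat_mem 3) (hat_mem 2)) (eps_mem 1) using 1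
    simp only [eps]
    group
  · convert mul_mem (mul_mem (mul_mem (mul_mem (mul_mem (eps_mem 3) (eps_mem 2)) (eps_mem 3))
      (eps_mem 1)) (eps_mem 3)) (eps_mem 2) using 1
    simp only [eps]
    group
  · convert one_mem Pos using 1
    simp only [eps]
    group
  · convert mul_mem (eps_mem 3) (eps_mem 2) using 1
    simp only [eps]
    group
  · convert one_mem Pos using 1
    simp only [eps]
    group

theorem exists_bl_cons (i : Fin 4) (l : List (Fin 4)) : (eps i)⁻¹ * bl (i :: l) ∈ Pos := by
  induction l generalizing i with
  | nil =>
    rw [bl_cons, if_neg (by simp [head]; omega), bl, mul_one]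
    exact eps_inv_mul_hat_mem i
  | cons j l ih =>
    rw [bl_cons]
    split_ifs with h
    · have hij : i < j := by
        rw [head_cons] at h
        omega
      convert mul_mem (eps_inv_mul_hat_inv_mem hij) (ih j) using 1
      group
    · convert mul_mem (mul_mem (eps_inv_mul_hat_mem i) (eps_mem j)) (ih j) using 1
      group

theorem bl_mem (l : List (Fin 4)) : bl l ∈ Pos := by
  cases l with
  | nil => exact one_mem _
  | cons i l =>
    convert mul_mem (eps_mem i) (exists_bl_cons i l) using 1
    group

theorem mem_pos_iff {x : Hat} : x ∈ Pos ↔ origin ≤ act x origin := by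
  refine ⟨origin_le_of_mem, fun h => ?_⟩
  obtain ⟨m, l, hl, rfl⟩ := exists_eq_bl x
  have h1 := Line.height_mono h
  have h2 := head_lt l
  rw [height_act m hl, height_origin] at h1
  lift m to ℕ using by omega
  rw [zpow_natCast]
  exact mul_mem (pow_mem center_mem m) (bl_mem l)

/-- The endomorphism underlying `braid j`. -/
def braidHom (j : Fin 3) : Hat →* Hat :=
  lift (fun i => if i = j.castSucc then hat j.succ else
      if i = j.succ then (hat j.succ)⁻¹ * hat j.castSucc * hat j.succ else hat i) (by
    suffices h : ∀ i, _ = center from fun i i' => (h i).trans (h i').symm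
    intro i
    split_ifs
    · exact hat_mul_self _
    · have : ∀ x y : Hat, x⁻¹ * y * x * (x⁻¹ * y * x) = x⁻¹ * (y * y) * x := fun x y => by group
      rw [this, hat_mul_self, mul_assoc, commute_center, inv_mul_cancel_left]
    · exact hat_mul_self _)

/-- The inverse of `braidHom j`. -/
def braidInv (j : Fin 3) : Hat →* Hat :=
  lift (fun i => if i = j.castSucc then hat j.castSucc * hat j.succ * (hat j.castSucc)⁻¹ else
      if i = j.succ then hat j.castSucc else hat i) (by
    suffices h : ∀ i, _ = center from fun i i' => (h i).trans (h i').symm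
    intro i
    split_ifs
    · have : ∀ x y : Hat, x * y * x⁻¹ * (x * y * x⁻¹) = x * (y * y) * x⁻¹ := fun x y => by group
      rw [this, hat_mul_self, ← commute_center, mul_inv_cancel_right]
    · exact hat_mul_self _
    · exact hat_mul_self _)

theorem braidHom_castSucc (j : Fin 3) : braidHom j (hat j.castSucc) = hat j.succ := by
  simp [braidHom]

theorem braidHom_succ (j : Fin 3) :
    braidHom j (hat j.succ) = (hat j.succ)⁻¹ * hat j.castSucc * hat j.succ := by
  rw [braidHom, lift_hat, if_neg (by simp [Fin.ext_iff]), if_pos rfl]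

theorem braidHom_of_ne {j : Fin 3} {i : Fin 4} (h : i ≠ j.castSucc) (h' : i ≠ j.succ) :
    braidHom j (hat i) = hat i := by
  simp [braidHom, h, h']

theorem braidInv_castSucc (j : Fin 3) :
    braidInv j (hat j.castSucc) = hat j.castSucc * hat j.succ * (hat j.castSucc)⁻¹ := by
  simp [braidInv]

theorem braidInv_succ (j : Fin 3) : braidInv j (hat j.succ) = hat j.castSucc := by
  rw [braidInv, lift_hat, if_neg (by simp [Fin.ext_iff]), if_pos rfl]

theorem braidInv_of_ne {j : Fin 3} {i : Fin 4} (h : i ≠ j.castSucc) (hi : i ≠ j.succ) :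
    braidInv j (hat i) = hat i := by
  simp [braidInv, h, hi]

/-- The braid automorphisms of `Hat`. -/
def braid (j : Fin 3) : Hat ≃* Hat :=
  MonoidHom.toMulEquiv (braidHom j) (braidInv j)
    (hom_ext fun i => by
      rw [MonoidHom.comp_apply, MonoidHom.id_apply]
      by_cases h : i = j.castSucc
      · rw [h, braidHom_castSucc, braidInv_succ]
      · by_cases h' : i = j.succ
        · rw [h', braidHom_succ, map_mul, map_mul, map_inv, braidInv_succ, braidInv_castSucc]
          group
        · rw [braidHom_of_ne h h', braidInv_of_ne h h'])
    (hom_ext fun i => by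
      rw [MonoidHom.comp_apply, MonoidHom.id_apply]
      by_cases h : i = j.castSucc
      · rw [h, braidInv_castSucc, map_mul, map_mul, map_inv, braidHom_castSucc, braidHom_succ]
        group
      · by_cases h' : i = j.succ
        · rw [h', braidInv_succ, braidHom_castSucc]
        · rw [braidInv_of_ne h h', braidHom_of_ne h h'])

theorem braid_castSucc (j : Fin 3) : braid j (hat j.castSucc) = hat j.succ := braidHom_castSucc j

theorem braid_succ (j : Fin 3) :
    braid j (hat j.succ) = (hat j.succ)⁻¹ * hat j.castSucc * hat j.succ := braidHom_succ j

theorem braid_of_ne {j : Fin 3} {i : Fin 4} (h : i ≠ j.castSucc) (h' : i ≠ j.succ) :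
    braid j (hat i) = hat i := braidHom_of_ne h h'

theorem braid_center (j : Fin 3) : braid j center = center := by
  rw [← hat_mul_self j.castSucc, map_mul, braid_castSucc, hat_mul_self, hat_mul_self]

theorem braid_mul_inv (j : Fin 3) (x : Hat) :
    braid j (hat j.castSucc * ((hat j.succ)⁻¹ * x)) =
      hat j.castSucc * ((hat j.succ)⁻¹ * braid j x) := by
  simp only [map_mul, map_inv, braid_castSucc, braid_succ]
  rw [← mul_assoc (hat j.castSucc), ← inv_mul_hat]
  group

theorem braid_inv_mul_inv (j : Fin 3) (x : Hat) :
    braid j ((hat j.castSucc)⁻¹ * ((hat j.succ)⁻¹ * x)) =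
      (hat j.castSucc)⁻¹ * ((hat j.succ)⁻¹ * braid j x) := by
  simp only [map_mul, map_inv, braid_castSucc, braid_succ, mul_inv_rev, inv_inv]
  have h : Commute ((hat j.succ)⁻¹ * (hat j.succ)⁻¹) (hat j.castSucc)⁻¹ := by
    rw [← mul_inv_rev, hat_mul_self]
    exact (show Commute center (hat j.castSucc) from commute_center _).inv_inv
  rw [← mul_assoc, ← mul_assoc, ← mul_assoc, h.eq]
  group

theorem braid_eps_mem (j : Fin 3) (i : Fin 4) : braid j (eps i) ∈ Pos := by
  have fixed : ∀ {j i}, braid j (eps i) = eps i → braid j (eps i) ∈ Pos := fun {j i} h => by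
    rw [h]
    exact eps_mem i
  have moved : ∀ {i' : Fin 4}, braid j (eps i) = hat i * eps i' → braid j (eps i) ∈ Pos :=
    fun {i'} h => by
      rw [h]
      exact mul_mem (hat_mem i) (eps_mem i')
  have hs := braid_succ j
  have h1 := braid_mul_inv j
  have h2 := braid_inv_mul_inv j
  have h1' : braid j (hat j.castSucc * (hat j.succ)⁻¹) = hat j.castSucc * (hat j.succ)⁻¹ := by
    simpa using h1 1
  have h2' : braid j ((hat j.castSucc)⁻¹ * (hat j.succ)⁻¹) =
      (hat j.castSucc)⁻¹ * (hat j.succ)⁻¹ := by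
    simpa [-map_mul] using h2 1
  have hne : ∀ i : Fin 4, i ≠ j.castSucc → i ≠ j.succ → braid j (hat i) = hat i :=
    fun i => braid_of_ne
  rw [inv_conj] at hs
  fin_cases j <;> simp only [Fin.reduceFinMk, Fin.zero_eta, Fin.reduceCastSucc, Fin.reduceSucc,
    Fin.castSucc_zero, Fin.succ_zero_eq_one] at *
  · have f2 := hne 2 (by decide) (by decide)
    have f3 := hne 3 (by decide) (by decide)
    fin_cases i
    · refine fixed ?_
      simp only [eps, mul_assoc, h1]
      simp only [map_mul, map_inv, f2, f3]
    · refine moved (i' := 0) ?_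
      simp only [eps, map_mul, map_inv, f2, f3, hs, mul_assoc]
      rfl
    · refine fixed ?_
      simp only [eps, map_mul, map_inv, f2, f3]
    · exact fixed f3
  · have f0 := hne 0 (by decide) (by decide)
    have f3 := hne 3 (by decide) (by decide)
    fin_cases i
    · refine fixed ?_
      simp only [eps, mul_assoc]
      rw [map_mul, h2, f0, map_inv, f3]
    · refine fixed ?_
      simp only [eps, mul_assoc, h1]
      simp only [map_inv, f3]
    · refine moved (i' := 1) ?_
      simp only [eps, map_mul, map_inv, f3, hs, mul_assoc]
      rfl
    · exact fixed f3
  · have f0 := hne 0 (by decide) (by decide)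
    have f1 := hne 1 (by decide) (by decide)
    fin_cases i
    · refine fixed ?_
      simp only [eps, mul_assoc]
      rw [map_mul, map_mul, h2', f0, map_inv, f1]
    · refine fixed ?_
      simp only [eps, mul_assoc]
      rw [map_mul, h2', f1]
    · refine fixed ?_
      simp only [eps, h1']
    · refine moved (i' := 2) ?_
      simp only [eps, hs, mul_assoc]
      rfl

theorem braid_mem {j : Fin 3} {x : Hat} (hx : x ∈ Pos) : braid j x ∈ Pos := by
  induction hx using Submonoid.closure_induction with
  | mem x hx =>
    obtain ⟨i, rfl⟩ := hx
    exact braid_eps_mem j i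
  | one => simp
  | mul x y _ _ hx hy => simpa using mul_mem hx hy

theorem braid_lt {j : Fin 3} {x y : Hat} (h : act x origin < act y origin) :
    act (braid j x) origin < act (braid j y) origin := by
  have h1 : origin < act (x⁻¹ * y) origin := by
    rw [map_mul, RelIso.mul_apply, map_inv]
    exact (act x).lt_symm_apply.2 h
  have h2 := origin_le_of_mem (braid_mem (j := j) (mem_pos_iff.2 h1.le))
  have h3 : origin ≠ act (braid j (x⁻¹ * y)) origin := by
    intro h3
    have h4 := (braid j).injective ((eq_one_of_act_origin h3.symm).trans (map_one _).symm)
    simp [h4] at h1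
  have h4 := lt_of_le_of_ne h2 h3
  rw [map_mul, map_mul, RelIso.mul_apply, map_inv, map_inv] at h4
  exact (act (braid j x)).lt_symm_apply.1 h4

theorem Low.braid {j : Fin 3} {x : Hat} (hx : Low x) : Low (braid j x) := by
  rw [low_iff_le_lt] at hx ⊢
  refine ⟨origin_le_of_mem (braid_mem (mem_pos_iff.2 hx.1)), ?_⟩
  simpa [braid_center] using braid_lt (j := j) hx.2

end Hat
end Positive

section Quotient

open Hat

instance : (Subgroup.zpowers center).Normal :=
  ⟨fun x hx g => by
    obtain ⟨m, rfl⟩ := Subgroup.mem_zpowers_iff.1 hx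
    rw [((show Commute center g from commute_center g).zpow_left m).symm.eq, mul_inv_cancel_right]
    exact hx⟩

/-- The free product of four groups of order two. -/
abbrev Cox : Type := Hat ⧸ Subgroup.zpowers center

/-- The generators of `Cox`. -/
def refl (i : Fin 4) : Cox := QuotientGroup.mk (hat i)

namespace Cox

theorem refl_mul_self (i : Fin 4) : refl i * refl i = 1 := by
  rw [refl, ← QuotientGroup.mk_mul, hat_mul_self, QuotientGroup.eq_one_iff]
  exact Subgroup.mem_zpowers center

@[simp] theorem refl_inv (i : Fin 4) : (refl i)⁻¹ = refl i :=
  inv_eq_of_mul_eq_one_right (refl_mul_self i)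

theorem refl_mul_refl_mul (i : Fin 4) (x : Cox) : refl i * (refl i * x) = x := by
  rw [← mul_assoc, refl_mul_self, one_mul]

/-- The universal property of `Cox`. -/
def lift {K : Type*} [Group K] (f : Fin 4 → K) (hf : ∀ i, f i * f i = 1) : Cox →* K :=
  QuotientGroup.lift _ (Hat.lift f fun i j => by rw [hf, hf]) fun x hx => by
    obtain ⟨m, rfl⟩ := Subgroup.mem_zpowers_iff.1 hx
    simp [center, hf]

@[simp] theorem lift_refl {K : Type*} [Group K] (f : Fin 4 → K) (hf : ∀ i, f i * f i = 1)
    (i : Fin 4) : lift f hf (refl i) = f i :=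
  Hat.lift_hat f (fun i j => by rw [hf, hf]) i

theorem hom_ext {K : Type*} [Group K] {f g : Cox →* K} (h : ∀ i, f (refl i) = g (refl i)) :
    f = g :=
  QuotientGroup.monoidHom_ext _ (Hat.hom_ext h)

theorem closure_refl : Subgroup.closure (Set.range refl) = ⊤ := by
  have h := congrArg (Subgroup.map (QuotientGroup.mk' (Subgroup.zpowers center))) closure_hat
  rw [MonoidHom.map_closure, ← Set.range_comp,
    Subgroup.map_top_of_surjective _ (QuotientGroup.mk'_surjective _)] at h
  exact h

/-- The value of a word in the generators. -/
def word (l : List (Fin 4)) : Cox := (l.map refl).prod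

@[simp] theorem word_nil : word [] = 1 := rfl

@[simp] theorem word_cons (i : Fin 4) (l : List (Fin 4)) : word (i :: l) = refl i * word l := by
  simp [word]

@[simp] theorem word_append (l l' : List (Fin 4)) : word (l ++ l') = word l * word l' := by
  simp [word]

theorem mk_bl (l : List (Fin 4)) : (QuotientGroup.mk (bl l) : Cox) = word l := by
  induction l with
  | nil => rfl
  | cons i l ih =>
    rw [bl_cons, QuotientGroup.mk_mul, ih, word_cons]
    split_ifs
    · rw [QuotientGroup.mk_inv, ← refl, refl_inv]
    · rfl

theorem exists_word {S : Set (Fin 4)} {g : Cox} (hg : g ∈ Subgroup.closure (refl '' S)) :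
    ∃ l : List (Fin 4), l.IsChain (· ≠ ·) ∧ (∀ i ∈ l, i ∈ S) ∧ g = word l := by
  have hmul : ∀ i ∈ S, ∀ g, (∃ l : List (Fin 4), l.IsChain (· ≠ ·) ∧ (∀ i ∈ l, i ∈ S) ∧
      g = word l) → ∃ l : List (Fin 4), l.IsChain (· ≠ ·) ∧ (∀ i ∈ l, i ∈ S) ∧
      refl i * g = word l := by
    rintro i hi g ⟨l, hl, hlS, rfl⟩
    by_cases h : (i :: l).IsChain (· ≠ ·)
    · exact ⟨i :: l, h, by simpa [hi] using hlS, by simp⟩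
    · cases l with
      | nil => simp at h
      | cons j l =>
        obtain rfl : i = j := by
          by_contra hij
          exact h (List.isChain_cons_cons.2 ⟨hij, hl⟩)
        exact ⟨l, hl.tail, fun k hk => hlS k (List.mem_cons_of_mem _ hk),
          by rw [word_cons, refl_mul_refl_mul]⟩
  induction hg using Subgroup.closure_induction_left with
  | one => exact ⟨[], by simp, by simp, rfl⟩
  | mul_left y hy x _ ih =>
    obtain ⟨i, hi, rfl⟩ := hy
    exact hmul i hi x ih
  | inv_mul_cancel y hy x _ ih =>
    obtain ⟨i, hi, rfl⟩ := hy
    rw [refl_inv]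
    exact hmul i hi x ih

theorem exists_word_eq (g : Cox) : ∃ l : List (Fin 4), l.IsChain (· ≠ ·) ∧ g = word l := by
  obtain ⟨l, hl, -, h⟩ := exists_word (S := Set.univ) (g := g)
    (by rw [Set.image_univ, closure_refl]; trivial)
  exact ⟨l, hl, h⟩

theorem exists_low (g : Cox) : ∃ x : Hat, Low x ∧ QuotientGroup.mk x = g := by
  obtain ⟨l, hl, rfl⟩ := exists_word_eq g
  exact ⟨bl l, low_iff.2 ⟨l, hl, rfl⟩, mk_bl l⟩

/-- The lift moving the origin into the fundamental domain of the centre. -/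
noncomputable def low (g : Cox) : Hat := (exists_low g).choose

theorem low_low (g : Cox) : Low (low g) := (exists_low g).choose_spec.1

@[simp] theorem mk_low (g : Cox) : (QuotientGroup.mk (low g) : Cox) = g :=
  (exists_low g).choose_spec.2

theorem low_eq {x : Hat} {g : Cox} (hx : Low x) (h : QuotientGroup.mk x = g) : low g = x := by
  rw [← mk_low g, QuotientGroup.eq] at h
  obtain ⟨m, hm⟩ := Subgroup.mem_zpowers_iff.1 h
  rw [eq_inv_mul_iff_mul_eq,
    ← ((show Commute center x from commute_center x).zpow_left m).eq] at hm
  have h1 := low_low g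
  rw [← hm, Low, map_mul, RelIso.mul_apply, act_center_zpow, Line.shift, Line.height_mk] at h1
  obtain ⟨h2, h3⟩ := hx
  obtain rfl : m = 0 := by omega
  rw [← hm]
  simp

/-- The position of a group element on the line. -/
noncomputable def ord (g : Cox) : Line := act (low g) origin

theorem ord_injective : Function.Injective ord := by
  intro g g' h
  have h1 : act ((low g')⁻¹ * low g) origin = origin := by
    rw [map_mul, RelIso.mul_apply, map_inv]
    exact (act (low g')).symm_apply_eq.2 h
  rw [← mk_low g, ← mk_low g', inv_mul_eq_one.1 (eq_one_of_act_origin h1)]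

theorem low_word {l : List (Fin 4)} (hl : l.IsChain (· ≠ ·)) : low (word l) = bl l :=
  low_eq (low_iff.2 ⟨l, hl, rfl⟩) (mk_bl l)

theorem height_ord_word {l : List (Fin 4)} (hl : l.IsChain (· ≠ ·)) :
    (ord (word l)).height = head l := by
  rw [ord, low_word hl, height_bl hl]

/-- The braid automorphisms of `Cox`. -/
def braid (j : Fin 3) : Cox ≃* Cox :=
  QuotientGroup.congr _ _ (Hat.braid j) (by
    rw [MonoidHom.map_zpowers]
    congr 1
    exact braid_center j)

theorem braid_mk (j : Fin 3) (x : Hat) :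
    braid j (QuotientGroup.mk x) = QuotientGroup.mk (Hat.braid j x) := rfl

theorem braid_castSucc (j : Fin 3) : braid j (refl j.castSucc) = refl j.succ := by
  rw [refl, braid_mk, Hat.braid_castSucc, refl]

theorem braid_succ (j : Fin 3) :
    braid j (refl j.succ) = refl j.succ * refl j.castSucc * refl j.succ := by
  rw [refl, braid_mk, Hat.braid_succ, QuotientGroup.mk_mul, QuotientGroup.mk_mul,
    QuotientGroup.mk_inv, ← refl, ← refl, refl_inv]

theorem braid_of_ne {j : Fin 3} {i : Fin 4} (h : i ≠ j.castSucc) (h' : i ≠ j.succ) :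
    braid j (refl i) = refl i := by
  rw [refl, braid_mk, Hat.braid_of_ne h h']

theorem ord_braid_lt {j : Fin 3} {g g' : Cox} (h : ord g < ord g') :
    ord (braid j g) < ord (braid j g') := by
  have key : ∀ g, low (braid j g) = Hat.braid j (low g) := fun g =>
    low_eq (low_low g).braid (by rw [← braid_mk, mk_low])
  rw [ord, ord, key, key]
  exact braid_lt h

/-- The automorphisms of `Cox` preserving the order of the line. -/
def monoAut : Subgroup (MulAut Cox) where
  carrier := {β | ∀ g g', ord (β g) < ord (β g') ↔ ord g < ord g'}
  one_mem' := fun _ _ => Iff.rfl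
  mul_mem' := fun h h' g g' => (h _ _).trans (h' _ _)
  inv_mem' := fun {β} h g g' => by simpa using (h (β⁻¹ g) (β⁻¹ g')).symm

theorem braid_mem_monoAut (j : Fin 3) : braid j ∈ monoAut := by
  intro g g'
  refine ⟨fun h => ?_, ord_braid_lt⟩
  by_contra h'
  rcases (not_lt.1 h').lt_or_eq with h'' | h''
  · exact h.not_gt (ord_braid_lt h'')
  · rw [ord_injective h''] at h
    exact h.false

/-- The subgroup generated by all generators but the first one. -/
def face : Subgroup Cox := Subgroup.closure (refl '' {i | i ≠ 0})

/-- The elements with first letter zero. -/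
def side : Set Cox := {g | (ord g).height = 1}

theorem word_mem_side {l : List (Fin 4)} (hl : l.IsChain (· ≠ ·)) :
    word l ∈ side ↔ ∃ l', l = 0 :: l' := by
  rw [side, Set.mem_ofPred_eq, height_ord_word hl]
  cases l with
  | nil => simp [head]
  | cons i l =>
    rw [head_cons, add_eq_right, Int.natCast_eq_zero, Fin.val_eq_zero_iff]
    simp

theorem height_ord_mul_refl (g : Cox) (i : Fin 4) :
    (ord (g * refl i)).height = (ord g).height ∨ g = 1 ∨ g = refl i := by
  obtain ⟨l, hl, rfl⟩ := exists_word_eq g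
  rcases l.eq_nil_or_concat' with rfl | ⟨l', j, rfl⟩
  · simp
  · have hl' := (List.isChain_append.1 hl).1
    by_cases hij : j = i
    · subst hij
      rcases l' with _ | ⟨k, l'⟩
      · simp
      · left
        rw [height_ord_word hl, word_append, word_cons j, word_nil, mul_one, mul_assoc,
          refl_mul_self, mul_one, height_ord_word hl']
        rfl
    · left
      have h : ((l' ++ [j]) ++ [i]).IsChain (· ≠ ·) :=
        List.isChain_append.2 ⟨hl, by simp, by simpa using hij⟩
      have h1 := height_ord_word h
      rw [word_append _ [i], word_cons, word_nil, mul_one] at h1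
      rw [h1, height_ord_word hl]
      cases l' <;> rfl

theorem refl_mem_face {i : Fin 4} (hi : i ≠ 0) : refl i ∈ face :=
  Subgroup.subset_closure ⟨i, hi, rfl⟩

theorem ord_one : ord 1 = origin := by
  rw [ord, ← word_nil, low_word (by simp)]
  simp [bl]

theorem ord_refl_zero : ord (refl 0) = Line.mk 1 fun _ => 3 := by
  have h : low (refl 0) = hat 0 := by
    have h := low_word (l := [0]) (by simp)
    simpa [bl, head] using h
  rw [ord, h, act_hat]
  refine Line.ext (by rw [Line.height_flip] <;> simp) fun k => ?_
  rw [Line.flip, if_neg (by simp), Line.digits_mk]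
  cases k <;> simp [Line.cons, origin]

theorem mem_side_iff {g : Cox} : g ∈ side ↔ origin < ord g ∧ ord g ≤ ord (refl 0) := by
  constructor
  · intro h
    change (ord g).height = 1 at h
    refine ⟨Line.lt_iff.2 (by simp [h]), not_lt.1 fun hlt => ?_⟩
    rw [Line.lt_iff, ord_refl_zero, Line.height_mk, h] at hlt
    obtain ⟨k, -, hk⟩ := (hlt.resolve_left (lt_irrefl _)).2
    simp only [Line.digits_mk, Fin.lt_def] at hk
    have := ((ord g).digits k).isLt
    simp at hk
    omega
  · rintro ⟨h1, h2⟩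
    obtain ⟨l, hl, rfl⟩ := exists_word_eq g
    have h3 := Line.height_mono h2
    rw [ord_refl_zero, Line.height_mk, height_ord_word hl] at h3
    rw [word_mem_side hl]
    cases l with
    | nil => simp [ord_one] at h1
    | cons i l =>
      rw [head_cons] at h3
      exact ⟨l, by congr 1; omega⟩

theorem bl_append_zero {l : List (Fin 4)} (hl : ∀ i ∈ l, i ≠ 0) : bl (l ++ [0]) = bl l * hat 0 := by
  induction l with
  | nil => simp [bl, head]
  | cons i l ih =>
    rw [List.cons_append, bl_cons, bl_cons, ih fun j hj => hl j (List.mem_cons_of_mem _ hj),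
      mul_assoc]
    congr 1
    cases l with
    | nil =>
      have h1 : ¬(i : ℤ) + 1 < head ([] ++ [0]) := by simp [head_cons]
      have h2 : ¬(i : ℤ) + 1 < head [] := by simp only [head]; omega
      rw [if_neg h1, if_neg h2]
    | cons j l => rfl

theorem isChain_append_zero {l : List (Fin 4)} (hl : l.IsChain (· ≠ ·)) (hl' : ∀ i ∈ l, i ≠ 0)
    {l₂ : List (Fin 4)} (h : (0 :: l₂).IsChain (· ≠ ·)) : (l ++ 0 :: l₂).IsChain (· ≠ ·) :=
  List.isChain_append.2 ⟨hl, h, fun x hx y hy => by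
    simp only [List.head?_cons, Option.mem_def, Option.some.injEq] at hy
    subst hy
    exact hl' x (List.mem_of_getLast? hx)⟩

theorem cut_interval {h : Cox} (hh : h ∈ face) (x : Cox) :
    h⁻¹ * x ∈ side ↔ ord h < ord x ∧ ord x ≤ ord (h * refl 0) := by
  obtain ⟨l, hl, hl0, rfl⟩ := exists_word hh
  have hc := isChain_append_zero hl hl0 (l₂ := []) (by simp)
  have h1 : low (word l * refl 0) = bl l * hat 0 := by
    rw [← bl_append_zero hl0, ← low_word hc]
    simp
  have h2 : low (refl 0) = hat 0 := by
    have h := low_word (l := [0]) (by simp)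
    simpa [bl, head] using h
  have hlow := low_iff_le_lt.1 (low_iff.2 ⟨_, hl, rfl⟩ : Low (bl l))
  have hlow' := low_iff_le_lt.1 (h1 ▸ low_low _ : Low (bl l * hat 0))
  rw [map_mul, RelIso.mul_apply] at hlow'
  rw [mem_side_iff]
  simp only [ord, h1, h2, low_word hl]
  rw [map_mul, RelIso.mul_apply]
  constructor
  · rintro ⟨h3, h4⟩
    have h5 : low x = bl l * low ((word l)⁻¹ * x) := by
      refine low_eq (low_iff_le_lt.2 ?_) ?_
      · rw [map_mul, RelIso.mul_apply]
        exact ⟨hlow.1.trans ((act (bl l)).monotone h3.le),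
          ((act (bl l)).monotone h4).trans_lt hlow'.2⟩
      · rw [QuotientGroup.mk_mul, mk_bl, mk_low, mul_inv_cancel_left]
    rw [h5, map_mul, RelIso.mul_apply]
    exact ⟨(act (bl l)).strictMono h3, (act (bl l)).monotone h4⟩
  · rintro ⟨h3, h4⟩
    have h3' : origin < act ((bl l)⁻¹ * low x) origin := by
      rw [map_mul, RelIso.mul_apply, map_inv]
      exact (act (bl l)).lt_symm_apply.2 h3
    have h4' : act ((bl l)⁻¹ * low x) origin ≤ act (hat 0) origin := by
      rw [map_mul, RelIso.mul_apply, map_inv]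
      exact (act (bl l)).symm_apply_le.2 h4
    have h6 : low ((word l)⁻¹ * x) = (bl l)⁻¹ * low x := by
      refine low_eq (low_iff_le_lt.2 ⟨h3'.le, h4'.trans_lt ?_⟩) ?_
      · rw [← h2]
        exact (low_iff_le_lt.1 (low_low _)).2
      · rw [QuotientGroup.mk_mul, QuotientGroup.mk_inv, mk_bl, mk_low]
    rw [h6]
    exact ⟨h3', h4'⟩

theorem cut_face : Cut ord face (refl 0) side where
  mem := by
    have h := word_mem_side (l := [0]) (by simp)
    simpa using h
  cover x hx := by
    obtain ⟨l, hl, rfl⟩ := exists_word_eq x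
    have key : ∀ l : List (Fin 4), l.IsChain (· ≠ ·) → word l ∈ face ∨
        ∃ h ∈ face, h⁻¹ * word l ∈ side := by
      intro l hl
      induction l with
      | nil => exact .inl (one_mem _)
      | cons i l ih =>
        by_cases hi : i = 0
        · subst hi
          exact .inr ⟨1, one_mem _, by rw [inv_one, one_mul, word_mem_side hl]; exact ⟨l, rfl⟩⟩
        · rw [word_cons]
          rcases ih hl.tail with h | ⟨h, hh, h'⟩
          · exact .inl (mul_mem (refl_mem_face hi) h)
          · exact .inr ⟨refl i * h, mul_mem (refl_mem_face hi) hh, by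
              convert h' using 1
              group⟩
    exact (key l hl).resolve_left hx
  disjoint x hx hx' := by
    obtain ⟨l, hl, hl0, rfl⟩ := exists_word hx'
    obtain ⟨l', rfl⟩ := (word_mem_side hl).1 hx
    exact hl0 0 (by simp) rfl
  unique x h hh k hk hx hx' := by
    obtain ⟨l, hl, hlx⟩ := exists_word_eq (h⁻¹ * x)
    rw [hlx, word_mem_side hl] at hx
    obtain ⟨l', rfl⟩ := hx
    obtain ⟨l₁, hl₁, hl₁0, hu⟩ := exists_word (mul_mem (inv_mem hk) hh)
    have hc := isChain_append_zero hl₁ hl₁0 hl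
    have h1 : k⁻¹ * x = word (l₁ ++ 0 :: l') := by
      rw [word_append, ← hlx, ← hu]
      group
    rw [h1, word_mem_side hc] at hx'
    obtain ⟨l'', hl''⟩ := hx'
    cases l₁ with
    | nil => exact (inv_mul_eq_one.1 hu).symm
    | cons i l₁ =>
      simp only [List.cons_append, List.cons.injEq] at hl''
      exact (hl₁0 i (by simp) hl''.1).elim
  right x hx h hh := by
    have key : ∀ i ≠ 0, ∀ x ∈ side, x * refl i ∈ side := by
      intro i hi x hx
      rcases height_ord_mul_refl x i with h | rfl | rfl
      · exact h.trans hx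
      · have := (word_mem_side (l := []) (by simp)).1 hx
        simp at this
      · have := (word_mem_side (l := [i]) (by simp)).1 (by simpa using hx)
        simp [hi] at this
    induction hh using Subgroup.closure_induction_right with
    | one => simpa using hx
    | mul_right y _ z hz ih =>
      obtain ⟨i, hi, rfl⟩ := hz
      rw [← mul_assoc]
      exact key i hi _ ih
    | mul_inv_cancel y _ z hz ih =>
      obtain ⟨i, hi, rfl⟩ := hz
      rw [← mul_assoc, refl_inv]
      exact key i hi _ ih
  interval h hh x := cut_interval hh x
  almostInvariant := by
    refine .of_generators closure_refl ?_
    rintro _ ⟨i, rfl⟩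
    refine (Set.toFinite {1, refl i}).subset fun g hg => ?_
    rcases height_ord_mul_refl g i with h | h
    · exact (hg (by simp only [side, Set.mem_ofPred_eq, h])).elim
    · exact h

theorem cut_map {β : MulAut Cox} (hβ : β ∈ monoAut) :
    Cut ord (face.map β.toMonoidHom) (β (refl 0)) (β.symm ⁻¹' side) where
  mem := by simpa using cut_face.mem
  cover x hx := by
    obtain ⟨h, hh, h'⟩ := cut_face.cover (β.symm x) fun h => hx ⟨_, h, by simp⟩
    exact ⟨β h, ⟨h, hh, rfl⟩, by simpa using h'⟩
  disjoint := by
    rintro _ hx ⟨y, hy, rfl⟩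
    exact cut_face.disjoint y (by simpa using hx) hy
  unique := by
    rintro x _ ⟨h, hh, rfl⟩ _ ⟨k, hk, rfl⟩ hx hx'
    rw [cut_face.unique (β.symm x) h hh k hk (by simpa using hx) (by simpa using hx')]
  right := by
    rintro x hx _ ⟨h, hh, rfl⟩
    simpa using cut_face.right _ hx h hh
  interval := by
    rintro _ ⟨h, hh, rfl⟩ x
    obtain ⟨x, rfl⟩ := β.surjective x
    have h1 := cut_face.interval h hh x
    have h2 := hβ h x
    have h3 := hβ (h * refl 0) x
    rw [← not_lt] at h1 ⊢
    rw [← h2, ← h3] at h1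
    simpa using h1
  almostInvariant := cut_face.almostInvariant.map_mulEquiv β

end Cox
end Quotient

open Gen

section Artin

/-- The universal property of the Artin group of type `D₄`. -/
def artinLift {K : Type*} [Group K] (f : Gen → K)
    (hbr : ∀ s, s ≠ d → f s * f d * f s = f d * f s * f d)
    (hco : ∀ s t, s ≠ d → t ≠ d → f s * f t = f t * f s) : Artin →* K :=
  PresentedGroup.toGroup (f := f) (by
    rintro _ ⟨s, t, hst, ⟨h, rfl⟩ | ⟨⟨hs, ht⟩, rfl⟩⟩
    · simp only [map_mul, map_inv, FreeGroup.lift_apply_of, mul_inv_eq_one]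
      rcases h with rfl | rfl
      · exact (hbr t hst.symm).symm
      · exact hbr s hst
    · simp only [map_mul, map_inv, FreeGroup.lift_apply_of, hco s t hs ht]
      group)

@[simp] theorem artinLift_gen {K : Type*} [Group K] (f : Gen → K)
    (hbr : ∀ s, s ≠ d → f s * f d * f s = f d * f s * f d)
    (hco : ∀ s t, s ≠ d → t ≠ d → f s * f t = f t * f s) (s : Gen) :
    artinLift f hbr hco (gen s) = f s :=
  PresentedGroup.toGroup.of _

theorem artin_hom_ext {K : Type*} [Group K] {f g : Artin →* K}
    (h : ∀ s, f (gen s) = g (gen s)) : f = g :=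
  PresentedGroup.ext h

theorem closure_gen : Subgroup.closure (Set.range gen) = ⊤ :=
  PresentedGroup.closure_range_of Rels

theorem gen_braid {s : Gen} (hs : s ≠ d) : gen s * gen d * gen s = gen d * gen s * gen d :=
  PresentedGroup.mk_eq_mk_of_mul_inv_mem ⟨s, d, hs, .inl ⟨.inr rfl, rfl⟩⟩

theorem gen_comm {s t : Gen} (hs : s ≠ d) (ht : t ≠ d) : gen s * gen t = gen t * gen s := by
  by_cases hst : s = t
  · rw [hst]
  · refine PresentedGroup.mk_eq_mk_of_mul_inv_mem ⟨s, t, hst, .inr ⟨⟨hs, ht⟩, ?_⟩⟩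
    group

theorem gen_mem_Ahat {s t : Gen} (h : t ≠ s) : gen t ∈ Ahat s :=
  Subgroup.subset_closure ⟨t, h, rfl⟩

/-- The transposition of the generators `a` and `b`. -/
def swapGen : Gen → Gen
  | a => b
  | b => a
  | c => c
  | d => d

theorem swapGen_ne {s : Gen} (hs : s ≠ d) : swapGen s ≠ d := by
  cases s <;> simp_all [swapGen]

@[simp] theorem swapGen_swapGen (s : Gen) : swapGen (swapGen s) = s := by
  cases s <;> rfl

/-- The endomorphism underlying `swap`. -/
def swapHom : Artin →* Artin :=
  artinLift (fun s => gen (swapGen s)) (fun _ hs => gen_braid (swapGen_ne hs))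
    fun _ _ hs ht => gen_comm (swapGen_ne hs) (swapGen_ne ht)

theorem swapHom_gen (s : Gen) : swapHom (gen s) = gen (swapGen s) :=
  artinLift_gen (fun s => gen (swapGen s)) _ _ s

theorem swapHom_comp : swapHom.comp swapHom = MonoidHom.id _ :=
  artin_hom_ext fun s => by
    rw [MonoidHom.comp_apply, swapHom_gen, swapHom_gen, swapGen_swapGen]
    rfl

/-- The automorphism exchanging the generators `a` and `b`. -/
def swap : MulAut Artin := MonoidHom.toMulEquiv swapHom swapHom swapHom_comp swapHom_comp

@[simp] theorem swap_gen (s : Gen) : swap (gen s) = gen (swapGen s) :=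
  swapHom_gen s

@[simp] theorem swap_swap (x : Artin) : swap (swap x) = x :=
  DFunLike.congr_fun swapHom_comp x

theorem swap_mul_swap : swap * swap = 1 := MulEquiv.ext swap_swap

theorem swap_mem_Ahat {s : Gen} {x : Artin} (hx : x ∈ Ahat s) : swap x ∈ Ahat (swapGen s) := by
  induction hx using Subgroup.closure_induction with
  | mem x hx =>
    obtain ⟨t, ht, rfl⟩ := hx
    rw [swap_gen]
    exact gen_mem_Ahat fun h => ht (by simpa using congrArg swapGen h)
  | one => simp
  | mul x y _ _ hx hy => simpa using mul_mem hx hy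
  | inv x _ hx => simpa using hx

/-- The homomorphism from the group of signs determined by an involution. -/
def signHom {K : Type*} [Group K] (x : K) (hx : x * x = 1) : ℤˣ →* K where
  toFun u := if u = 1 then 1 else x
  map_one' := by simp
  map_mul' u v := by
    rcases Int.units_eq_one_or u with rfl | rfl <;> rcases Int.units_eq_one_or v with rfl | rfl <;>
      simp [hx]

@[simp] theorem signHom_neg_one {K : Type*} [Group K] (x : K) (hx : x * x = 1) :
    signHom x hx (-1) = x := by
  simp [signHom]

end Artin

section Holomorph

namespace Cox

theorem braid_zero_refl_zero : braid 0 (refl 0) = refl 1 := braid_castSucc 0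
theorem braid_zero_refl_one : braid 0 (refl 1) = refl 1 * refl 0 * refl 1 := braid_succ 0
theorem braid_zero_refl_two : braid 0 (refl 2) = refl 2 := braid_of_ne (by decide) (by decide)
theorem braid_zero_refl_three : braid 0 (refl 3) = refl 3 := braid_of_ne (by decide) (by decide)
theorem braid_one_refl_zero : braid 1 (refl 0) = refl 0 := braid_of_ne (by decide) (by decide)
theorem braid_one_refl_one : braid 1 (refl 1) = refl 2 := braid_castSucc 1
theorem braid_one_refl_two : braid 1 (refl 2) = refl 2 * refl 1 * refl 2 := braid_succ 1
theorem braid_one_refl_three : braid 1 (refl 3) = refl 3 := braid_of_ne (by decide) (by decide)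
theorem braid_two_refl_zero : braid 2 (refl 0) = refl 0 := braid_of_ne (by decide) (by decide)
theorem braid_two_refl_one : braid 2 (refl 1) = refl 1 := braid_of_ne (by decide) (by decide)
theorem braid_two_refl_two : braid 2 (refl 2) = refl 3 := braid_castSucc 2
theorem braid_two_refl_three : braid 2 (refl 3) = refl 3 * refl 2 * refl 3 := braid_succ 2

attribute [simp] braid_zero_refl_zero braid_zero_refl_one braid_zero_refl_two braid_zero_refl_three
  braid_one_refl_zero braid_one_refl_one braid_one_refl_two braid_one_refl_three
  braid_two_refl_zero braid_two_refl_one braid_two_refl_two braid_two_refl_three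

theorem aut_ext {f g : MulAut Cox} (h : ∀ i, f (refl i) = g (refl i)) : f = g :=
  MulEquiv.toMonoidHom_injective (hom_ext h)

theorem braid_zero_one : (braid 0 * braid 1 * braid 0 : MulAut Cox) = braid 1 * braid 0 * braid 1 :=
  aut_ext fun i => by
    fin_cases i <;> simp [MulAut.mul_apply, mul_assoc, refl_mul_refl_mul]

theorem braid_two_one : (braid 2 * braid 1 * braid 2 : MulAut Cox) = braid 1 * braid 2 * braid 1 :=
  aut_ext fun i => by
    fin_cases i <;> simp [MulAut.mul_apply, mul_assoc, refl_mul_refl_mul]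

theorem braid_two_zero : (braid 2 * braid 0 : MulAut Cox) = braid 0 * braid 2 :=
  aut_ext fun i => by
    fin_cases i <;> simp [MulAut.mul_apply]

end Cox

open Cox

/-- The holomorph of `Cox`. -/
abbrev CoxHol : Type := Cox ⋊[MonoidHom.id (MulAut Cox)] MulAut Cox

/-- The translation by the last generator of `Cox`. -/
def transl : CoxHol := SemidirectProduct.inl (refl 3)

theorem transl_mul_self : transl * transl = 1 := by
  rw [transl, ← map_mul, refl_mul_self, map_one]

theorem transl_comm {f : MulAut Cox} (hf : f (refl 3) = refl 3) :
    transl * SemidirectProduct.inr f = SemidirectProduct.inr f * transl :=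
  SemidirectProduct.ext (by simp [transl, hf]) (by simp [transl])

/-- The images of the Artin generators in the holomorph of `Cox`. -/
def holGen : Gen → CoxHol
  | a => transl * SemidirectProduct.inr (braid 2) * transl
  | b => SemidirectProduct.inr (braid 2)
  | c => SemidirectProduct.inr (braid 0)
  | d => SemidirectProduct.inr (braid 1)

theorem transl_holGen_transl (s : Gen) : transl * holGen s * transl = holGen (swapGen s) := by
  have h : ∀ x : CoxHol, transl * (transl * x) = x := fun x => by
    rw [← mul_assoc, transl_mul_self, one_mul]
  cases s <;> simp only [holGen, swapGen, mul_assoc, h, transl_mul_self, mul_one]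
  · rw [← transl_comm braid_zero_refl_three, h]
  · rw [← transl_comm braid_one_refl_three, h]

theorem holGen_a_comm_b : holGen a * holGen b = holGen b * holGen a := by
  refine SemidirectProduct.ext ?_ ?_
  · simp [holGen, transl, mul_assoc, refl_mul_refl_mul]
  · simp [holGen, transl]

theorem holGen_conj {x y : Gen} : holGen (swapGen x) * holGen (swapGen y) =
    transl * (holGen x * holGen y) * transl := by
  rw [← transl_holGen_transl, ← transl_holGen_transl]
  simp only [mul_assoc]
  rw [← mul_assoc transl transl, transl_mul_self, one_mul]

theorem holGen_comm (s t : Gen) (hs : s ≠ d) (ht : t ≠ d) :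
    holGen s * holGen t = holGen t * holGen s := by
  have hbc : holGen b * holGen c = holGen c * holGen b := by
    simp only [holGen, ← map_mul]
    exact congrArg _ braid_two_zero
  have hac : holGen a * holGen c = holGen c * holGen a := by
    have h1 := holGen_conj (x := b) (y := c)
    have h2 := holGen_conj (x := c) (y := b)
    rw [hbc, ← h2] at h1
    exact h1
  cases s <;> cases t <;>
    first
    | rfl
    | exact (hs rfl).elim
    | exact (ht rfl).elim
    | exact holGen_a_comm_b
    | exact holGen_a_comm_b.symm
    | exact hbc
    | exact hbc.symm
    | exact hac
    | exact hac.symm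

theorem holGen_braid (s : Gen) (hs : s ≠ d) :
    holGen s * holGen d * holGen s = holGen d * holGen s * holGen d := by
  have hb : holGen b * holGen d * holGen b = holGen d * holGen b * holGen d := by
    simp only [holGen, ← map_mul]
    exact congrArg _ braid_two_one
  cases s with
  | a =>
    have h1 : ∀ x y z, holGen (swapGen x) * holGen (swapGen y) * holGen (swapGen z) =
        transl * (holGen x * holGen y * holGen z) * transl := fun x y z => by
      rw [holGen_conj, ← transl_holGen_transl z]
      simp only [mul_assoc]
      rw [← mul_assoc transl transl, transl_mul_self, one_mul]
    have h2 := h1 b d b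
    rw [hb, ← h1] at h2
    exact h2
  | b => exact hb
  | c =>
    simp only [holGen, ← map_mul]
    exact congrArg _ braid_zero_one
  | d => exact (hs rfl).elim

/-- The affine action of the Artin group on `Cox`. -/
def hol : Artin →* CoxHol := artinLift holGen holGen_braid holGen_comm

@[simp] theorem hol_gen (s : Gen) : hol (gen s) = holGen s := artinLift_gen _ _ _ s

theorem hol_swap (x : Artin) : hol (swap x) = transl * hol x * transl := by
  have h : hol.comp swap.toMonoidHom = (MulAut.conj transl).toMonoidHom.comp hol :=
    artin_hom_ext fun s => by
      simp [← transl_holGen_transl, inv_eq_of_mul_eq_one_right transl_mul_self]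
  simpa [inv_eq_of_mul_eq_one_right transl_mul_self] using DFunLike.congr_fun h x

/-- The extension of the Artin group by the exchange of `a` and `b`. -/
abbrev Ext : Type := Artin ⋊[signHom swap swap_mul_swap] ℤˣ

/-- The involution of `Ext` exchanging `a` and `b`. -/
def invol : Ext := SemidirectProduct.inr (-1)

theorem invol_mul_self : invol * invol = 1 := by
  rw [invol, ← map_mul]
  simp

theorem invol_mul_inl (x : Artin) :
    invol * SemidirectProduct.inl x = SemidirectProduct.inl (swap x) * invol :=
  SemidirectProduct.ext (by simp [invol]) (by simp [invol])

/-- The extension of `hol`. -/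
def holExt : Ext →* CoxHol :=
  SemidirectProduct.lift hol (signHom transl transl_mul_self) fun u => by
    rcases Int.units_eq_one_or u with rfl | rfl
    · ext x <;> simp
    · refine MonoidHom.ext fun x => ?_
      simp [hol_swap, inv_eq_of_mul_eq_one_right transl_mul_self]

@[simp] theorem holExt_inl (x : Artin) : holExt (SemidirectProduct.inl x) = hol x := by
  simp [holExt]

@[simp] theorem holExt_invol : holExt invol = transl := by
  simp [holExt, invol]

end Holomorph

section Section

open Cox

/-- The Artin generators in `Ext`. -/
def extGen (s : Gen) : Ext := SemidirectProduct.inl (gen s)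

theorem extGen_comm {s t : Gen} (hs : s ≠ d) (ht : t ≠ d) : Commute (extGen s) (extGen t) := by
  rw [Commute, SemiconjBy, extGen, extGen, ← map_mul, gen_comm hs ht, map_mul]

theorem extGen_braid {s : Gen} (hs : s ≠ d) :
    extGen s * extGen d * extGen s = extGen d * extGen s * extGen d := by
  simp only [extGen, ← map_mul, gen_braid hs]

theorem invol_semiconj (s : Gen) : SemiconjBy invol (extGen s) (extGen (swapGen s)) := by
  rw [SemiconjBy, extGen, invol_mul_inl, swap_gen, extGen]

theorem mul_inv_mul_eq_of_braid {K : Type*} [Group K] {x y : K} (h : x * y * x = y * x * y) :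
    x * y * x⁻¹ = y⁻¹ * x * y := by
  rw [mul_inv_eq_iff_eq_mul, mul_assoc, mul_assoc, eq_inv_mul_iff_mul_eq, ← mul_assoc,
    ← mul_assoc, h]

/-- The second reflection in `Ext`. -/
def twist : Ext := extGen a * (extGen b)⁻¹ * invol

theorem twist_mul_self : twist * twist = 1 := by
  have h : SemiconjBy invol (extGen a * (extGen b)⁻¹) (extGen b * (extGen a)⁻¹) :=
    (invol_semiconj a).mul_right (invol_semiconj b).inv_right
  rw [twist, mul_assoc, ← mul_assoc invol, h.eq, mul_assoc _ invol, invol_mul_self]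
  group

theorem twist_comm_c : Commute (extGen c) twist :=
  ((extGen_comm (s := c) (t := a) (by simp) (by simp)).mul_right
    (extGen_comm (s := c) (t := b) (by simp) (by simp)).inv_right).mul_right
    (show Commute _ _ from invol_semiconj c).symm

theorem conj_b_twist : SemiconjBy (extGen b) twist invol := by
  rw [SemiconjBy, (invol_semiconj b).eq, twist,
    ((extGen_comm (s := a) (t := b) (by simp) (by simp)).inv_right).eq]
  simp [swapGen, mul_assoc]

theorem conj_b_invol : SemiconjBy (extGen b) invol (invol * twist * invol) := by
  rw [SemiconjBy, twist]
  simp only [mul_assoc]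
  rw [← mul_assoc invol invol, invol_mul_self, one_mul, inv_mul_cancel, mul_one,
    (invol_semiconj a).eq]
  rfl

theorem conj_b_conj_twist :
    Commute (extGen b) ((extGen d)⁻¹ * twist * extGen d) := by
  have h1 : extGen d * extGen b * (extGen d)⁻¹ = (extGen b)⁻¹ * extGen d * extGen b :=
    mul_inv_mul_eq_of_braid (extGen_braid (by simp)).symm
  have hba := (extGen_comm (s := b) (t := a) (by simp) (by simp))
  have h2 : extGen b * ((extGen d)⁻¹ * (extGen a * (extGen b)⁻¹) * extGen d) =
      (extGen d)⁻¹ * (extGen a * (extGen b)⁻¹) * extGen d * extGen a := by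
    refine mul_left_cancel (a := extGen d) ?_
    calc _ = (extGen d * extGen b * (extGen d)⁻¹) * extGen a * (extGen b)⁻¹ * extGen d := by group
      _ = (extGen b)⁻¹ * extGen d * (extGen b * extGen a) * (extGen b)⁻¹ * extGen d := by
        rw [h1]; group
      _ = (extGen b)⁻¹ * (extGen d * extGen a * extGen d) := by rw [hba.eq]; group
      _ = ((extGen b)⁻¹ * extGen a) * extGen d * extGen a := by
        rw [← extGen_braid (s := a) (by simp)]; group
      _ = _ := by rw [hba.inv_left.eq]; group
  have hd : invol * extGen d = extGen d * invol := invol_semiconj d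
  have hb : invol * extGen b = extGen a * invol := invol_semiconj b
  have h3 : (extGen d)⁻¹ * twist * extGen d =
      (extGen d)⁻¹ * (extGen a * (extGen b)⁻¹) * extGen d * invol := by
    rw [twist, ← mul_assoc, mul_assoc _ invol, hd, ← mul_assoc]
  rw [Commute, SemiconjBy, h3, ← mul_assoc, h2, mul_assoc _ invol, hb, mul_assoc, mul_assoc]

theorem conj_d_twist : extGen d * twist * (extGen d)⁻¹ =
    twist * ((extGen d)⁻¹ * twist * extGen d) * twist := by
  have hd : Commute invol (extGen d) := invol_semiconj d
  have h : SemiconjBy invol (extGen a * (extGen b)⁻¹) (extGen b * (extGen a)⁻¹) :=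
    (invol_semiconj a).mul_right (invol_semiconj b).inv_right
  have h' : SemiconjBy invol (extGen b * (extGen a)⁻¹) (extGen a * (extGen b)⁻¹) :=
    (invol_semiconj b).mul_right (invol_semiconj a).inv_right
  have hba : extGen b * extGen a = extGen a * extGen b :=
    (extGen_comm (s := b) (t := a) (by simp) (by simp))
  have hb := extGen_braid (s := b) (by simp)
  have h1 : extGen d * extGen a * (extGen d)⁻¹ = (extGen a)⁻¹ * extGen d * extGen a :=
    mul_inv_mul_eq_of_braid (extGen_braid (by simp)).symm
  have hdt : extGen d * extGen b * (extGen a)⁻¹ * extGen d * extGen a * (extGen b)⁻¹ *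
      (extGen d)⁻¹ =
      extGen b * (extGen a)⁻¹ * extGen d * extGen a * (extGen b)⁻¹ := by
    calc _ = extGen d * extGen b * ((extGen a)⁻¹ * extGen d * extGen a) * (extGen b)⁻¹ *
          (extGen d)⁻¹ := by group
      _ = (extGen d * extGen b * extGen d) * extGen a * ((extGen d)⁻¹ * (extGen b)⁻¹ *
          (extGen d)⁻¹) := by rw [← h1]; group
      _ = (extGen b * extGen d * extGen b) * extGen a * ((extGen b)⁻¹ * (extGen d)⁻¹ *
          (extGen b)⁻¹) := by
        have hb' : (extGen d)⁻¹ * (extGen b)⁻¹ * (extGen d)⁻¹ =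
            (extGen b)⁻¹ * (extGen d)⁻¹ * (extGen b)⁻¹ := by
          simpa [mul_assoc] using congrArg (·⁻¹) hb.symm
        rw [← hb, hb']
      _ = extGen b * extGen d * (extGen b * extGen a) * (extGen b)⁻¹ * (extGen d)⁻¹ *
          (extGen b)⁻¹ := by group
      _ = extGen b * (extGen d * extGen a * (extGen d)⁻¹) * (extGen b)⁻¹ := by rw [hba]; group
      _ = _ := by rw [h1]; group
  have h5 : twist * ((extGen d)⁻¹ * twist * extGen d) * twist =
      extGen a * (extGen b)⁻¹ * (extGen d)⁻¹ * (extGen b * (extGen a)⁻¹) * extGen d *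
        (extGen a * (extGen b)⁻¹) * invol := by
    calc _ = extGen a * (extGen b)⁻¹ * (invol * (extGen d)⁻¹) * (extGen a * (extGen b)⁻¹) *
          (invol * extGen d) * (extGen a * (extGen b)⁻¹) * invol := by rw [twist]; group
      _ = extGen a * (extGen b)⁻¹ * (extGen d)⁻¹ * (invol * (extGen a * (extGen b)⁻¹)) * extGen d *
          (invol * (extGen a * (extGen b)⁻¹)) * invol := by rw [hd.eq, hd.inv_right.eq]; group
      _ = extGen a * (extGen b)⁻¹ * (extGen d)⁻¹ * (extGen b * (extGen a)⁻¹) * (invol * extGen d) *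
          (extGen b * (extGen a)⁻¹) * (invol * invol) := by rw [h.eq]; group
      _ = extGen a * (extGen b)⁻¹ * (extGen d)⁻¹ * (extGen b * (extGen a)⁻¹) * extGen d *
          (invol * (extGen b * (extGen a)⁻¹)) := by rw [hd.eq, invol_mul_self]; group
      _ = _ := by
        rw [h'.eq]
        group
  have h6 : extGen d * extGen a * (extGen b)⁻¹ * (extGen d)⁻¹ = extGen a * (extGen b)⁻¹ *
      (extGen d)⁻¹ * (extGen b * (extGen a)⁻¹) * extGen d * (extGen a * (extGen b)⁻¹) := by
    rw [← mul_right_inj (extGen d * extGen b * (extGen a)⁻¹)]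
    refine Eq.trans ?_ (hdt.trans ?_) <;> group
  calc _ = extGen d * extGen a * (extGen b)⁻¹ * (invol * (extGen d)⁻¹) := by rw [twist]; group
    _ = extGen d * extGen a * (extGen b)⁻¹ * (extGen d)⁻¹ * invol := by
      rw [hd.inv_right.eq]; group
    _ = _ := by rw [h5, h6]

/-- The third reflection in `Ext`. -/
def twist' : Ext := (extGen d)⁻¹ * twist * extGen d

/-- The fourth reflection in `Ext`. -/
def twist'' : Ext := (extGen c)⁻¹ * twist' * extGen c

theorem twist'_mul_self : twist' * twist' = 1 := by
  calc _ = (extGen d)⁻¹ * (twist * twist) * extGen d := by rw [twist']; group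
    _ = 1 := by rw [twist_mul_self]; group

theorem twist''_mul_self : twist'' * twist'' = 1 := by
  calc _ = (extGen c)⁻¹ * (twist' * twist') * extGen c := by rw [twist'']; group
    _ = 1 := by rw [twist'_mul_self]; group

theorem conj_d_twist'' : Commute (extGen d) twist'' := by
  have hc := extGen_braid (s := c) (by simp)
  have h : extGen d * (extGen c)⁻¹ * (extGen d)⁻¹ = (extGen c)⁻¹ * (extGen d)⁻¹ * extGen c := by
    have := congrArg (·⁻¹) (mul_inv_mul_eq_of_braid hc.symm)
    simpa [mul_assoc] using this
  calc extGen d * twist'' = extGen d * (extGen c)⁻¹ * (extGen d)⁻¹ * twist * extGen d *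
        extGen c := by rw [twist'', twist']; group
    _ = (extGen c)⁻¹ * (extGen d)⁻¹ * (extGen c * twist) * extGen d * extGen c := by rw [h]; group
    _ = (extGen c)⁻¹ * (extGen d)⁻¹ * twist * (extGen c * extGen d * extGen c) := by
      rw [twist_comm_c.eq]; group
    _ = _ := by rw [hc, twist'', twist']; group

theorem conj_c_twist' : extGen c * twist' * (extGen c)⁻¹ = twist' * twist'' * twist' := by
  have hc := extGen_braid (s := c) (by simp)
  have h1 : extGen d * extGen c * (extGen d)⁻¹ = (extGen c)⁻¹ * extGen d * extGen c :=
    mul_inv_mul_eq_of_braid hc.symm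
  have h2 : extGen d * (extGen c)⁻¹ * (extGen d)⁻¹ = (extGen c)⁻¹ * (extGen d)⁻¹ * extGen c := by
    simpa [mul_assoc] using congrArg (·⁻¹) h1
  have h3 : extGen c * extGen d * (extGen c)⁻¹ = (extGen d)⁻¹ * extGen c * extGen d :=
    mul_inv_mul_eq_of_braid hc
  have h4 : extGen c * (extGen d)⁻¹ * (extGen c)⁻¹ = (extGen d)⁻¹ * (extGen c)⁻¹ * extGen d := by
    simpa [mul_assoc] using congrArg (·⁻¹) h3
  have ht := twist_comm_c
  symm
  calc _ = (extGen d)⁻¹ * twist * (extGen d * (extGen c)⁻¹ * (extGen d)⁻¹) * twist *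
        (extGen d * extGen c * (extGen d)⁻¹) * twist * extGen d := by
        rw [twist'', twist']; group
    _ = (extGen d)⁻¹ * (twist * (extGen c)⁻¹) * (extGen d)⁻¹ * (extGen c * twist) * (extGen c)⁻¹ *
        extGen d * (extGen c * twist) * extGen d := by rw [h1, h2]; group
    _ = (extGen d)⁻¹ * (extGen c)⁻¹ * (twist * ((extGen d)⁻¹ * twist * extGen d) * twist) *
        extGen c * extGen d := by rw [ht.eq, ← ht.inv_left.eq]; group
    _ = ((extGen d)⁻¹ * (extGen c)⁻¹ * extGen d) * twist *
        ((extGen d)⁻¹ * extGen c * extGen d) := by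
      rw [← conj_d_twist]; group
    _ = extGen c * (extGen d)⁻¹ * ((extGen c)⁻¹ * twist) * extGen c * extGen d * (extGen c)⁻¹ := by
      rw [← h3, ← h4]; group
    _ = _ := by rw [ht.inv_left.eq, twist']; group

/-- A homomorphism from `Cox` splitting `holExt` over the translations. -/
def sec : Cox →* Ext :=
  lift ![twist'', twist', twist, invol] fun i => by
    fin_cases i
    exacts [twist''_mul_self, twist'_mul_self, twist_mul_self, invol_mul_self]

@[simp] theorem sec_zero : sec (refl 0) = twist'' := lift_refl _ _ 0
@[simp] theorem sec_one : sec (refl 1) = twist' := lift_refl _ _ 1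
@[simp] theorem sec_two : sec (refl 2) = twist := lift_refl _ _ 2
@[simp] theorem sec_three : sec (refl 3) = invol := lift_refl _ _ 3

theorem semiconj_sec_of_refl {x : Ext} {f : Cox ≃* Cox}
    (h : ∀ i, SemiconjBy x (sec (refl i)) (sec (f (refl i)))) (g : Cox) :
    SemiconjBy x (sec g) (sec (f g)) := by
  have h' : (MulAut.conj x).toMonoidHom.comp sec = sec.comp f.toMonoidHom :=
    hom_ext fun i => by simp [(h i).eq]
  have := DFunLike.congr_fun h' g
  simpa [SemiconjBy, mul_inv_eq_iff_eq_mul] using this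

theorem semiconj_b_sec (g : Cox) : SemiconjBy (extGen b) (sec g) (sec (braid 2 g)) := by
  have h : Commute (extGen b) twist' := conj_b_conj_twist
  refine semiconj_sec_of_refl (fun i => ?_) g
  fin_cases i
  · simpa using show SemiconjBy _ twist'' twist'' from
      ((extGen_comm (s := b) (t := c) (by simp) (by simp)).inv_right.mul_right h).mul_right
      (extGen_comm (by simp) (by simp))
  · simpa using show SemiconjBy _ _ _ from h
  · simpa using conj_b_twist
  · simpa using conj_b_invol

theorem semiconj_d_sec (g : Cox) : SemiconjBy (extGen d) (sec g) (sec (braid 1 g)) := by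
  refine semiconj_sec_of_refl (fun i => ?_) g
  fin_cases i
  · simpa using show SemiconjBy _ _ _ from conj_d_twist''
  · simp [SemiconjBy, twist', mul_assoc]
  · simpa [SemiconjBy, mul_inv_eq_iff_eq_mul, twist'] using conj_d_twist
  · simpa using show SemiconjBy _ _ _ from (show Commute _ _ from invol_semiconj d).symm

theorem semiconj_c_sec (g : Cox) : SemiconjBy (extGen c) (sec g) (sec (braid 0 g)) := by
  refine semiconj_sec_of_refl (fun i => ?_) g
  fin_cases i
  · simp [SemiconjBy, twist'', mul_assoc]
  · simpa [SemiconjBy, mul_inv_eq_iff_eq_mul] using conj_c_twist'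
  · simpa using show SemiconjBy _ _ _ from twist_comm_c
  · simpa using show SemiconjBy _ _ _ from (show Commute _ _ from invol_semiconj c).symm

end Section

section Vertices

open Cox

theorem holExt_twist : holExt twist = SemidirectProduct.inl (refl 2) := by
  simp only [twist, extGen, map_mul, map_inv, holExt_inl, hol_gen, holExt_invol, holGen]
  refine SemidirectProduct.ext ?_ ?_
  · simp [transl, mul_assoc, refl_mul_refl_mul, refl_mul_self]
  · simp [transl]

theorem holExt_twist' : holExt twist' = SemidirectProduct.inl (refl 1) := by
  simp only [twist', extGen, map_mul, map_inv, holExt_inl, hol_gen, holExt_twist, holGen, mul_assoc]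
  rw [inv_mul_eq_iff_eq_mul]
  exact SemidirectProduct.ext (by simp) (by simp)

theorem holExt_twist'' : holExt twist'' = SemidirectProduct.inl (refl 0) := by
  simp only [twist'', extGen, map_mul, map_inv, holExt_inl, hol_gen, holExt_twist', holGen,
    mul_assoc]
  rw [inv_mul_eq_iff_eq_mul]
  exact SemidirectProduct.ext (by simp) (by simp)

theorem holExt_sec (g : Cox) : holExt (sec g) = SemidirectProduct.inl g := by
  have h : holExt.comp sec = SemidirectProduct.inl := hom_ext fun i => by
    fin_cases i
    · simpa using holExt_twist''
    · simpa using holExt_twist'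
    · simpa using holExt_twist
    · simp [transl]
  exact DFunLike.congr_fun h g

theorem exists_semiconj_sec {k : Artin} (hk : k ∈ Ahat a) : ∃ f : Cox ≃* Cox,
    ∀ g, SemiconjBy (SemidirectProduct.inl k : Ext) (sec g) (sec (f g)) := by
  induction hk using Subgroup.closure_induction with
  | mem x hx =>
    obtain ⟨t, ht, rfl⟩ := hx
    cases t with
    | a => exact (ht rfl).elim
    | b => exact ⟨_, semiconj_b_sec⟩
    | c => exact ⟨_, semiconj_c_sec⟩
    | d => exact ⟨_, semiconj_d_sec⟩
  | one => exact ⟨MulEquiv.refl _, fun g => by simp⟩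
  | mul x y _ _ hx hy =>
    obtain ⟨f, hf⟩ := hx
    obtain ⟨f', hf'⟩ := hy
    refine ⟨f'.trans f, fun g => ?_⟩
    rw [map_mul]
    exact (hf _).mul_left (hf' g)
  | inv x _ hx =>
    obtain ⟨f, hf⟩ := hx
    refine ⟨f.symm, fun g => ?_⟩
    have := hf (f.symm g)
    rw [f.apply_symm_apply] at this
    rw [map_inv]
    exact this.inv_symm_left

theorem exists_inl_eq_sec_mul (g : Artin) :
    ∃ γ, ∃ k ∈ Ahat a, (SemidirectProduct.inl g : Ext) = sec γ * SemidirectProduct.inl k := by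
  have hg : g ∈ Subgroup.closure (Set.range gen) := by rw [closure_gen]; trivial
  induction hg using Subgroup.closure_induction with
  | mem x hx =>
    obtain ⟨t, rfl⟩ := hx
    by_cases ht : t = a
    · subst ht
      refine ⟨refl 2 * refl 3, gen b, gen_mem_Ahat (by simp), ?_⟩
      rw [map_mul, sec_two, sec_three, twist, mul_assoc _ invol invol, invol_mul_self, mul_one,
        extGen, extGen, inv_mul_cancel_right]
    · exact ⟨1, gen t, gen_mem_Ahat ht, by simp⟩
  | one => exact ⟨1, 1, one_mem _, by simp⟩
  | mul x y _ _ hx hy =>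
    obtain ⟨γ, k, hk, h⟩ := hx
    obtain ⟨γ', k', hk', h'⟩ := hy
    obtain ⟨f, hf⟩ := exists_semiconj_sec hk
    refine ⟨γ * f γ', k * k', mul_mem hk hk', ?_⟩
    rw [map_mul, h, h', map_mul, map_mul, mul_assoc, ← mul_assoc (SemidirectProduct.inl k),
      (hf γ').eq]
    simp only [mul_assoc]
  | inv x _ hx =>
    obtain ⟨γ, k, hk, h⟩ := hx
    obtain ⟨f, hf⟩ := exists_semiconj_sec (inv_mem hk)
    refine ⟨f γ⁻¹, k⁻¹, inv_mem hk, ?_⟩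
    rw [← (hf _).eq, map_inv, h, mul_inv_rev, map_inv, map_inv]

theorem hol_left_of_mem_Ahat {k : Artin} (hk : k ∈ Ahat a) : (hol k).left = 1 := by
  induction hk using Subgroup.closure_induction with
  | mem x hx =>
    obtain ⟨t, ht, rfl⟩ := hx
    cases t with
    | a => exact (ht rfl).elim
    | b | c | d => simp [holGen]
  | one => simp
  | mul x y _ _ hx hy => simp [hx, hy]
  | inv x _ hx => simp [hx]

theorem exists_inl_eq_sec_left_mul (g : Artin) : ∃ k ∈ Ahat a,
    (SemidirectProduct.inl g : Ext) = sec (hol g).left * SemidirectProduct.inl k := by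
  obtain ⟨γ, k, hk, h⟩ := exists_inl_eq_sec_mul g
  have hleft := congrArg (fun x => (holExt x).left) h
  simp only [map_mul, holExt_inl, holExt_sec, SemidirectProduct.mul_left,
    SemidirectProduct.left_inl, hol_left_of_mem_Ahat hk, map_one, mul_one] at hleft
  exact ⟨k, hk, by rw [hleft, h]⟩

/-- The group element attached to a left coset of `Ahat a`. -/
def ptA (g : Artin) : Cox := (hol g).left

/-- The group element attached to a left coset of `Ahat b`. -/
def ptB (g : Artin) : Cox := (hol g).left * (hol g).right (refl 3)

theorem ptA_mul (g h : Artin) : ptA (g * h) = ptA g * (hol g).right (ptA h) := by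
  simp [ptA]

theorem ptB_mul (g h : Artin) : ptB (g * h) = ptA g * (hol g).right (ptB h) := by
  simp [ptA, ptB, mul_assoc]

theorem refl_mul_ptA_swap (g : Artin) : refl 3 * ptA (swap g) = ptB g := by
  simp [ptA, ptB, hol_swap, transl, mul_assoc, refl_mul_refl_mul]

theorem ptA_eq_iff {g h : Artin} : ptA g = ptA h ↔ g⁻¹ * h ∈ Ahat a := by
  constructor
  · intro hgh
    obtain ⟨k, hk, h1⟩ := exists_inl_eq_sec_left_mul g
    obtain ⟨k', hk', h2⟩ := exists_inl_eq_sec_left_mul h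
    have h3 : (hol g).left = (hol h).left := hgh
    have h4 : g⁻¹ * h = k⁻¹ * k' :=
      SemidirectProduct.inl_injective (φ := signHom swap swap_mul_swap) (by
      rw [map_mul, map_inv, h1, h2, h3, map_mul, map_inv]
      group)
    rw [h4]
    exact mul_mem (inv_mem hk) hk'
  · intro hgh
    have h1 : ptA (g⁻¹ * h) = 1 := hol_left_of_mem_Ahat hgh
    rw [← mul_inv_cancel_left g h, ptA_mul, h1, map_one, mul_one]

theorem ptB_eq_iff {g h : Artin} : ptB g = ptB h ↔ g⁻¹ * h ∈ Ahat b := by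
  rw [← refl_mul_ptA_swap, ← refl_mul_ptA_swap, mul_right_inj, ptA_eq_iff, ← map_inv, ← map_mul]
  refine ⟨fun h => ?_, swap_mem_Ahat⟩
  simpa [swapGen] using swap_mem_Ahat h

theorem sec_ptA_right (g : Artin) : (sec (ptA g)).right = 1 := by
  obtain ⟨k, -, h⟩ := exists_inl_eq_sec_left_mul g
  simpa [ptA] using (congrArg SemidirectProduct.right h).symm

theorem sec_ptB_right (g : Artin) : (sec (ptB g)).right = -1 := by
  rw [← refl_mul_ptA_swap, map_mul, sec_three, SemidirectProduct.mul_right, sec_ptA_right]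
  simp [invol]

theorem ptA_ne_ptB (g h : Artin) : ptA g ≠ ptB h := fun hgh => by
  have := sec_ptA_right g
  rw [hgh, sec_ptB_right] at this
  exact absurd this (by decide)

/-- The elements of `Ext` whose Artin part lies in `Ahat c`. -/
def extFace : Subgroup Ext where
  carrier := {x | x.left ∈ Ahat c}
  one_mem' := show (1 : Ext).left ∈ Ahat c from one_mem _
  mul_mem' {x y} hx hy := by
    replace hy : y.left ∈ Ahat c := hy
    refine mul_mem (show x.left ∈ Ahat c from hx) ?_
    rcases Int.units_eq_one_or x.right with h | h <;> rw [h]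
    · simpa using hy
    · simpa [swapGen] using swap_mem_Ahat hy
  inv_mem' {x} hx := by
    have hx' : x.left⁻¹ ∈ Ahat c := inv_mem hx
    change x⁻¹.left ∈ Ahat c
    rw [SemidirectProduct.inv_left]
    rcases Int.units_eq_one_or x.right with h | h <;> rw [h]
    · simpa using hx'
    · simpa [swapGen] using swap_mem_Ahat hx'

theorem mem_extFace {x : Ext} : x ∈ extFace ↔ x.left ∈ Ahat c := Iff.rfl

theorem extGen_mem_extFace {s : Gen} (hs : s ≠ c) : extGen s ∈ extFace :=
  mem_extFace.2 (gen_mem_Ahat hs)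

theorem sec_mem_extFace {γ : Cox} (hγ : γ ∈ face) : sec γ ∈ extFace := by
  have h3 : invol ∈ extFace := mem_extFace.2 (one_mem (Ahat c))
  have h2 : twist ∈ extFace := mul_mem (mul_mem (extGen_mem_extFace (by simp))
    (inv_mem (extGen_mem_extFace (by simp)))) h3
  have h1 : twist' ∈ extFace := mul_mem (mul_mem (inv_mem (extGen_mem_extFace (by simp))) h2)
    (extGen_mem_extFace (by simp))
  suffices h : face ≤ extFace.comap sec from h hγ
  refine (Subgroup.closure_le _).2 ?_
  rintro _ ⟨i, hi, rfl⟩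
  fin_cases i
  · exact (hi rfl).elim
  · simpa using h1
  · simpa using h2
  · simpa using h3

theorem exists_pt_eq {γ : Cox} (hγ : γ ∈ face) : ∃ n ∈ Ahat c, γ = ptA n ∨ γ = ptB n := by
  refine ⟨(sec γ).left, mem_extFace.1 (sec_mem_extFace hγ), ?_⟩
  have h := holExt_sec γ
  rw [← SemidirectProduct.inl_left_mul_inr_right (sec γ), map_mul, holExt_inl] at h
  have h' := congrArg SemidirectProduct.left h
  rcases Int.units_eq_one_or (sec γ).right with hr | hr
  · left
    rw [hr] at h'
    simpa [ptA] using h'.symm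
  · right
    rw [hr, ← invol, holExt_invol] at h'
    simpa [transl, ptB] using h'.symm

theorem braid_mem_face {j : Fin 3} (hj : j ≠ 0) {g : Cox} : braid j g ∈ face ↔ g ∈ face := by
  have h1 := refl_mem_face (i := 1) (by decide)
  have h2 := refl_mem_face (i := 2) (by decide)
  have h3 := refl_mem_face (i := 3) (by decide)
  have hle : face ≤ face.comap (braid j).toMonoidHom := by
    refine (Subgroup.closure_le _).2 ?_
    rintro _ ⟨i, hi, rfl⟩
    fin_cases j
    · exact (hj rfl).elim
    all_goals
      fin_cases i
      · exact (hi rfl).elim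
      all_goals simp [h1, h2, h3, mul_mem]
  have hge : face ≤ face.map (braid j).toMonoidHom := by
    refine (Subgroup.closure_le _).2 ?_
    rintro _ ⟨i, hi, rfl⟩
    fin_cases j
    · exact (hj rfl).elim
    · fin_cases i
      · exact (hi rfl).elim
      · exact ⟨refl 1 * refl 2 * refl 1, mul_mem (mul_mem h1 h2) h1,
          by simp [mul_assoc, refl_mul_refl_mul, refl_mul_self]⟩
      · exact ⟨refl 1, h1, by simp⟩
      · exact ⟨refl 3, h3, by simp⟩
    · fin_cases i
      · exact (hi rfl).elim
      · exact ⟨refl 1, h1, by simp⟩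
      · exact ⟨refl 2 * refl 3 * refl 2, mul_mem (mul_mem h2 h3) h2,
          by simp [mul_assoc, refl_mul_refl_mul, refl_mul_self]⟩
      · exact ⟨refl 2, h2, by simp⟩
  refine ⟨fun h => ?_, fun h => hle h⟩
  obtain ⟨x, hx, hxg⟩ := hge h
  rwa [← (braid j).injective hxg]

/-- The affine maps of `Cox` preserving `face`. -/
def holFace : Subgroup CoxHol where
  carrier := {x | x.left ∈ face ∧ ∀ g, x.right g ∈ face ↔ g ∈ face}
  one_mem' := ⟨one_mem _, fun _ => Iff.rfl⟩
  mul_mem' {x y} hx hy := ⟨mul_mem hx.1 ((hx.2 _).2 hy.1), fun g => (hx.2 _).trans (hy.2 g)⟩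
  inv_mem' {x} hx := by
    have h : ∀ g, x.right⁻¹ g ∈ face ↔ g ∈ face := fun g => by
      rw [← hx.2, MulAut.apply_inv_self]
    exact ⟨(h _).2 (inv_mem hx.1), h⟩

theorem hol_mem_holFace {n : Artin} (hn : n ∈ Ahat c) : hol n ∈ holFace := by
  have ht : transl ∈ holFace := ⟨refl_mem_face (by decide), fun _ => Iff.rfl⟩
  have hb : ∀ j : Fin 3, j ≠ 0 → SemidirectProduct.inr (braid j) ∈ holFace :=
    fun j hj => ⟨one_mem _, fun _ => braid_mem_face hj⟩
  suffices h : Ahat c ≤ holFace.comap hol from h hn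
  refine (Subgroup.closure_le _).2 ?_
  rintro _ ⟨t, ht', rfl⟩
  rw [SetLike.mem_coe, Subgroup.mem_comap, hol_gen]
  cases t with
  | a => exact mul_mem (mul_mem ht (hb 2 (by decide))) ht
  | b => exact hb 2 (by decide)
  | c => exact (ht' rfl).elim
  | d => exact hb 1 (by decide)

theorem ptA_mem_face {n : Artin} (hn : n ∈ Ahat c) : ptA n ∈ face := (hol_mem_holFace hn).1

theorem ptB_mem_face {n : Artin} (hn : n ∈ Ahat c) : ptB n ∈ face :=
  mul_mem (hol_mem_holFace hn).1 (((hol_mem_holFace hn).2 _).2 (refl_mem_face (by decide)))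

theorem hol_right_mem_monoAut (g : Artin) : (hol g).right ∈ monoAut := by
  suffices h : ⊤ ≤ (monoAut.comap SemidirectProduct.rightHom).comap hol from h (Subgroup.mem_top g)
  rw [← closure_gen, Subgroup.closure_le]
  rintro _ ⟨t, rfl⟩
  cases t <;> simp [holGen, transl, braid_mem_monoAut]

theorem exists_common_vertex {ι : Type*} [Finite ι] [LinearOrder ι] [Nonempty ι] (g : ι → Artin)
    (h : ∀ i j, ∃ m ∈ Ahat c, ∃ n ∈ Ahat c,
      (g i * m)⁻¹ * (g j * n) ∈ Ahat a ∨ (g i * m)⁻¹ * (g j * n) ∈ Ahat b) :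
    ∃ w, ∃ s, (s = a ∨ s = b) ∧ ∀ i, ∃ n ∈ Ahat c, w⁻¹ * (g i * n) ∈ Ahat s := by
  have hpt : ∀ i j, ∃ y, (ptA (g i))⁻¹ * y ∈ face.map (hol (g i)).right.toMonoidHom ∧
      (ptA (g j))⁻¹ * y ∈ face.map (hol (g j)).right.toMonoidHom := by
    intro i j
    obtain ⟨m, hm, n, hn, h | h⟩ := h i j
    · refine ⟨ptA (g i * m), ⟨ptA m, ptA_mem_face hm, ?_⟩, ⟨ptA n, ptA_mem_face hn, ?_⟩⟩
      · simp [ptA_mul]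
      · simp [ptA_eq_iff.2 h, ptA_mul (g j)]
    · refine ⟨ptB (g i * m), ⟨ptB m, ptB_mem_face hm, ?_⟩, ⟨ptB n, ptB_mem_face hn, ?_⟩⟩
      · simp [ptB_mul]
      · simp [ptB_eq_iff.2 h, ptB_mul (g j)]
  choose y hy using hpt
  obtain ⟨z, hz⟩ := exists_common ord_injective
    (fun i => cut_map (hol_right_mem_monoAut (g i))) closure_refl
    (by rintro _ ⟨i, rfl⟩; exact refl_mul_self i) (fun i => ptA (g i)) y hy
  have hz' : ∀ i, ∃ n ∈ Ahat c, z = ptA (g i * n) ∨ z = ptB (g i * n) := by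
    intro i
    obtain ⟨γ, hγ, hγz⟩ := hz i
    obtain ⟨n, hn, h⟩ := exists_pt_eq hγ
    have hz : z = ptA (g i) * (hol (g i)).right γ := eq_mul_of_inv_mul_eq hγz.symm
    refine ⟨n, hn, h.imp ?_ ?_⟩ <;> rintro rfl
    · rw [hz, ptA_mul]
    · rw [hz, ptB_mul]
  let i₀ : ι := Classical.arbitrary ι
  obtain ⟨n₀, -, h₀ | h₀⟩ := hz' i₀
  · refine ⟨g i₀ * n₀, a, .inl rfl, fun i => ?_⟩
    obtain ⟨n, hn, h | h⟩ := hz' i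
    · exact ⟨n, hn, ptA_eq_iff.1 (h₀.symm.trans h)⟩
    · exact (ptA_ne_ptB _ _ (h₀.symm.trans h)).elim
  · refine ⟨g i₀ * n₀, b, .inr rfl, fun i => ?_⟩
    obtain ⟨n, hn, h | h⟩ := hz' i
    · exact (ptA_ne_ptB _ _ (h.symm.trans h₀)).elim
    · exact ⟨n, hn, ptB_eq_iff.1 (h₀.symm.trans h)⟩

theorem exists_mul_of_inter_nonempty {X Z : Set Artin} {H K : Subgroup Artin} {g w : Artin}
    (hX : X = g • (H : Set Artin)) (hZ : Z = w • (K : Set Artin)) (h : (Z ∩ X).Nonempty) :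
    ∃ n ∈ H, w⁻¹ * (g * n) ∈ K := by
  subst hX hZ
  obtain ⟨_, ⟨k, hk, rfl⟩, ⟨n, hn, hnk⟩⟩ := h
  refine ⟨n, hn, ?_⟩
  simp only [smul_eq_mul] at hnk
  rw [hnk, inv_mul_cancel_left]
  exact hk

theorem inter_nonempty_of_mul_mem {H K : Subgroup Artin} {g w n : Artin} (hn : n ∈ H)
    (h : w⁻¹ * (g * n) ∈ K) : (w • (K : Set Artin) ∩ g • (H : Set Artin)).Nonempty :=
  ⟨g * n, ⟨w⁻¹ * (g * n), h, mul_inv_cancel_left _ _⟩, ⟨n, hn, rfl⟩⟩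

theorem exists_inv_mul_mem {Z : Set Artin} {X X' : Set Artin} {H K : Subgroup Artin} {g g' : Artin}
    (hX : X = g • (H : Set Artin)) (hX' : X' = g' • (H : Set Artin)) (hZ : IsCosetOf Z K)
    (h : (Z ∩ X).Nonempty) (h' : (Z ∩ X').Nonempty) :
    ∃ m ∈ H, ∃ n ∈ H, (g * m)⁻¹ * (g' * n) ∈ K := by
  obtain ⟨w, hw⟩ := hZ
  obtain ⟨m, hm, h1⟩ := exists_mul_of_inter_nonempty hX hw h
  obtain ⟨n, hn, h2⟩ := exists_mul_of_inter_nonempty hX' hw h'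
  exact ⟨m, hm, n, hn, by simpa [mul_assoc] using mul_mem (inv_mem h1) h2⟩

end Vertices

end D4Artin

open D4Artin D4Artin.Gen

/-- Every type II 6-cycle in the `D₄` Artin complex satisfies property `(*)`. -/
theorem typeII_six_cycle_property_star (x : Fin 6 → Set Artin) (hx : TypeII x) :
    Star x := by
  obtain ⟨h0, h4, h2, ⟨g₁, h1⟩, ⟨g₃, h3⟩, ⟨g₅, h5⟩, -, -, -, -, h⟩ := hx
  have swp : ∀ {X Y : Set Artin}, (X ∩ Y).Nonempty → (Y ∩ X).Nonempty := fun {X Y} h => by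
    rwa [Set.inter_comm]
  have h01 : (x 0 ∩ x 1).Nonempty := h 0
  have h12 : (x 1 ∩ x 2).Nonempty := h 1
  have h23 : (x 2 ∩ x 3).Nonempty := h 2
  have h34 : (x 3 ∩ x 4).Nonempty := h 3
  have h45 : (x 4 ∩ x 5).Nonempty := h 4
  have h50 : (x 5 ∩ x 0).Nonempty := h 5
  obtain ⟨w, s, hs, hw⟩ := exists_common_vertex ![g₁, g₃, g₅] (by
    intro i j
    have key : ∀ {i j : Artin}, (∃ m ∈ Ahat c, ∃ n ∈ Ahat c, (i * m)⁻¹ * (j * n) ∈ Ahat a) →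
        ∃ m ∈ Ahat c, ∃ n ∈ Ahat c,
          (i * m)⁻¹ * (j * n) ∈ Ahat a ∨ (i * m)⁻¹ * (j * n) ∈ Ahat b :=
      fun ⟨m, hm, n, hn, h⟩ => ⟨m, hm, n, hn, .inl h⟩
    have key' : ∀ {i j : Artin}, (∃ m ∈ Ahat c, ∃ n ∈ Ahat c, (i * m)⁻¹ * (j * n) ∈ Ahat b) →
        ∃ m ∈ Ahat c, ∃ n ∈ Ahat c,
          (i * m)⁻¹ * (j * n) ∈ Ahat a ∨ (i * m)⁻¹ * (j * n) ∈ Ahat b :=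
      fun ⟨m, hm, n, hn, h⟩ => ⟨m, hm, n, hn, .inr h⟩
    fin_cases i <;> fin_cases j
    · exact key (exists_inv_mul_mem h1 h1 h0 h01 h01)
    · exact key' (exists_inv_mul_mem h1 h3 h2 (swp h12) h23)
    · exact key (exists_inv_mul_mem h1 h5 h0 h01 (swp h50))
    · exact key' (exists_inv_mul_mem h3 h1 h2 h23 (swp h12))
    · exact key' (exists_inv_mul_mem h3 h3 h2 h23 h23)
    · exact key (exists_inv_mul_mem h3 h5 h4 (swp h34) h45)
    · exact key (exists_inv_mul_mem h5 h1 h0 (swp h50) h01)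
    · exact key (exists_inv_mul_mem h5 h3 h4 h45 (swp h34))
    · exact key (exists_inv_mul_mem h5 h5 h4 h45 h45))
  refine ⟨w • (Ahat s : Set Artin), hs.imp ?_ ?_, ?_, ?_, ?_⟩
  · rintro rfl
    exact ⟨w, rfl⟩
  · rintro rfl
    exact ⟨w, rfl⟩
  · obtain ⟨n, hn, hm⟩ := hw 0
    rw [h1]
    exact inter_nonempty_of_mul_mem hn hm
  · obtain ⟨n, hn, hm⟩ := hw 1
    rw [h3]
    exact inter_nonempty_of_mul_mem hn hm
  · obtain ⟨n, hn, hm⟩ := hw 2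
    rw [h5]
    exact inter_nonempty_of_mul_mem hn hm
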